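/- Let $A$ be an analytically unramified Noetherian local ring and $I$ an ideal of $A$. Then the integral closure filtration $\{\overline{I^n}\}_{n \ge 0}$ is an $I$-good filtration; equivalently, there exists $c$ such that $\overline{I^{n+1}} = I\,\overline{I^n}$ for all $n \ge c$. -/

import Mathlib

/-- The integral closure `Ī` of an ideal `I`: the ideal generated by (in fact, equal to)
the set of `x ∈ A` satisfying an equation `x^k + a₁x^{k-1} + ⋯ + a_k = 0` with
`a_j ∈ I^j`. -/
def idealIC {A : Type*} [CommRing A] (I : Ideal A) : Ideal A :=
  Ideal.span {x : A | ∃ k : ℕ, 0 < k ∧ ∃ a : ℕ → A,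
    (∀ j : ℕ, 1 ≤ j → j ≤ k → a j ∈ I ^ j) ∧
    x ^ k + ∑ j ∈ Finset.Icc 1 k, a j * x ^ (k - j) = 0}

universe u

theorem IsPrecomplete.pi_fin {T : Type*} [CommRing T] (J : Ideal T) [IsPrecomplete J T] (n : ℕ) :
    IsPrecomplete J (Fin n → T) := by
  have key : ∀ k (x : Fin n → T), x ∈ (J ^ k • ⊤ : Submodule T (Fin n → T)) ↔ ∀ i, x i ∈ J ^ k := by
    intro k x
    constructor
    · intro hx i
      have : (J ^ k • ⊤ : Submodule T (Fin n → T)).map (LinearMap.proj i) ≤ J ^ k • ⊤ := by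
        rw [Submodule.map_smul'']
        exact Submodule.smul_mono le_rfl le_top
      have h2 := this (Submodule.mem_map_of_mem (f := LinearMap.proj i) hx)
      simpa using h2
    · intro h
      rw [pi_eq_sum_univ' x]
      exact Submodule.sum_mem _ fun i _ => Submodule.smul_mem_smul (h i) trivial
  refine ⟨fun f hf => ?_⟩
  have : ∀ i, ∃ L : T, ∀ k, f k i ≡ L [SMOD (J ^ k • ⊤ : Submodule T T)] := by
    intro i
    apply IsPrecomplete.prec ‹_›
    intro a b hab
    have := hf hab
    rw [SModEq.sub_mem, key] at this
    rw [SModEq.sub_mem]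
    simpa using this i
  choose L hL using this
  refine ⟨L, fun k => ?_⟩
  rw [SModEq.sub_mem, key]
  intro i
  have := hL i k
  rw [SModEq.sub_mem] at this
  simpa using this

/-- Complete Nakayama lemma. -/
theorem Module.Finite.of_isPrecomplete_of_sup_eq_top {T M : Type*} [CommRing T] [AddCommGroup M]
    [Module T M] (J : Ideal T) [IsPrecomplete J T] [IsHausdorff J M] (N : Submodule T M)
    (hN : N.FG) (h : N ⊔ J • ⊤ = ⊤) : N = ⊤ := by
  obtain ⟨n, v, rfl⟩ := Submodule.fg_iff_exists_fin_generating_family.mp hN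
  have := IsPrecomplete.pi_fin J n
  have hs : Function.Surjective (Fintype.linearCombination T v) := by
    apply surjective_of_mkQ_comp_surjective (I := J)
    intro y
    obtain ⟨m, rfl⟩ := Submodule.mkQ_surjective _ y
    have hm : m ∈ Submodule.span T (Set.range v) ⊔ J • ⊤ := by rw [h]; trivial
    obtain ⟨a, ha, b, hb, rfl⟩ := Submodule.mem_sup.mp hm
    obtain ⟨c, rfl⟩ : ∃ c, Fintype.linearCombination T v c = a := by
      rw [← Fintype.range_linearCombination] at ha
      exact ha
    refine ⟨c, ?_⟩
    simp only [LinearMap.comp_apply, map_add, left_eq_add]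
    simpa using hb
  rw [← Fintype.range_linearCombination, LinearMap.range_eq_top.mpr hs]

/-- A surjective image of a precomplete ring is precomplete. -/
theorem IsPrecomplete.of_surjective {T R : Type*} [CommRing T] [CommRing R] (J : Ideal T)
    [IsPrecomplete J T] (f : T →+* R) (hf : Function.Surjective f) :
    IsPrecomplete (J.map f) R := by
  refine ⟨fun g hg => ?_⟩
  have step : ∀ n (t : T), f t = g n → ∃ t', f t' = g (n + 1) ∧ t' - t ∈ J ^ n := by
    intro n t ht
    have := hg (Nat.le_succ n)
    rw [SModEq.sub_mem, smul_eq_mul, Ideal.mul_top, ← Ideal.map_pow,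
      Ideal.mem_map_iff_of_surjective _ hf] at this
    obtain ⟨a, ha, hfa⟩ := this
    exact ⟨t - a, by rw [map_sub, hfa, ht]; simp, by simpa using ha⟩
  choose! s hs1 hs2 using step
  obtain ⟨t0, ht0⟩ := hf (g 0)
  let u : ℕ → T := fun n => Nat.rec t0 (fun n t => s n t) n
  have hu : ∀ n, f (u n) = g n := by
    intro n
    induction n with
    | zero => exact ht0
    | succ n ih => exact hs1 n _ ih
  have hu2 : ∀ n, u (n + 1) - u n ∈ J ^ n := fun n => hs2 n _ (hu n)
  have hu3 : ∀ {m n}, m ≤ n → u n - u m ∈ J ^ m := by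
    intro m n hmn
    induction n, hmn using Nat.le_induction with
    | base => simp
    | succ n hmn ih =>
      have := (J ^ m).add_mem ih (Ideal.pow_le_pow_right hmn (hu2 n))
      simpa using this
  obtain ⟨L, hL⟩ := IsPrecomplete.prec ‹IsPrecomplete J T› (f := u) (by
    intro m n hmn
    rw [SModEq.sub_mem, smul_eq_mul, Ideal.mul_top, ← neg_mem_iff, neg_sub]
    exact hu3 hmn)
  refine ⟨f L, fun n => ?_⟩
  have := hL n
  rw [SModEq.sub_mem, smul_eq_mul, Ideal.mul_top] at this
  rw [SModEq.sub_mem, smul_eq_mul, Ideal.mul_top, ← Ideal.map_pow, ← hu n, ← map_sub]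
  exact Ideal.mem_map_of_mem f this

/-- A nontrivial quotient of a complete Noetherian local ring is a complete local ring. -/
theorem IsAdicComplete.of_surjective_of_isLocalRing {T R : Type*} [CommRing T] [CommRing R]
    [IsLocalRing T] [IsNoetherianRing T] [IsLocalRing R]
    [IsAdicComplete (IsLocalRing.maximalIdeal T) T] (f : T →+* R) (hf : Function.Surjective f) :
    IsAdicComplete (IsLocalRing.maximalIdeal R) R := by
  have : IsNoetherianRing R := isNoetherianRing_of_surjective T R f hf
  have h := IsLocalRing.map_maximalIdeal_of_surjective f hf
  have := IsPrecomplete.of_surjective (IsLocalRing.maximalIdeal T) f hf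
  rw [h] at this
  exact { }

theorem AdicCompletion.exists_ringHom_extension {T R : Type*} [CommRing T] [CommRing R]
    (J : Ideal T) (I : Ideal R) [IsAdicComplete I R] (g : T →+* R) (h : J.map g ≤ I) :
    ∃ G : AdicCompletion J T →+* R, ∀ t, G (algebraMap T _ t) = g t := by
  have hle : ∀ n, J ^ n ≤ (I ^ n).comap g := fun n => by
    rw [← Ideal.map_le_iff_le_comap, Ideal.map_pow]
    exact Ideal.pow_right_mono h n
  let f : (n : ℕ) → AdicCompletion J T →+* R ⧸ I ^ n := fun n =>
    (Ideal.quotientMap (I ^ n) g (hle n)).comp (evalₐ J n : AdicCompletion J T →+* _)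
  have hf : ∀ {m n : ℕ} (hmn : m ≤ n), (Ideal.Quotient.factorPow I hmn).comp (f n) = f m := by
    intro m n hmn
    ext x
    obtain ⟨x, rfl⟩ := AdicCompletion.mk_surjective J T x
    change Ideal.Quotient.mk (I ^ m) (g (x.1 n)) = Ideal.Quotient.mk (I ^ m) (g (x.1 m))
    rw [Ideal.Quotient.eq, ← map_sub]
    exact hle m (Ideal.Quotient.eq.mp (AdicCompletion.Ideal.mk_eq_mk J hmn x))
  refine ⟨IsAdicComplete.liftRingHom I f hf, fun t => ?_⟩
  rw [← sub_eq_zero]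
  apply IsHausdorff.haus (I := I) inferInstance
  intro n
  rw [SModEq.sub_mem, smul_eq_mul, Ideal.mul_top, sub_zero, ← Ideal.Quotient.eq,
    IsAdicComplete.mk_liftRingHom]
  simp [f, AdicCompletion.algebraMap_apply]

theorem MvPowerSeries.exists_ringHom_extension {σ A R : Type*} [Finite σ] [CommRing A]
    [CommRing R] (I : Ideal R) [IsAdicComplete I R] (φ : A →+* R) (x : σ → R)
    (hx : ∀ i, x i ∈ I) :
    ∃ G : MvPowerSeries σ A →+* R, (∀ a, G (C a) = φ a) ∧ ∀ i, G (X i) = x i := by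
  obtain ⟨G, hG⟩ := AdicCompletion.exists_ringHom_extension (MvPolynomial.idealOfVars σ A) I
    (MvPolynomial.eval₂Hom φ x) (by
      rw [MvPolynomial.idealOfVars, Ideal.map_span, Ideal.span_le]
      rintro _ ⟨_, ⟨i, rfl⟩, rfl⟩
      simpa using hx i)
  have key : ∀ p : MvPolynomial σ A, G (toAdicCompletion σ A (p : MvPowerSeries σ A)) =
      MvPolynomial.eval₂Hom φ x p := by
    intro p
    rw [toAdicCompletion_coe, ← hG p, AdicCompletion.algebraMap_apply]
    rfl
  refine ⟨G.comp (toAdicCompletion σ A : MvPowerSeries σ A →+* _), fun a => ?_, fun i => ?_⟩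
  · simpa using key (MvPolynomial.C a)
  · simpa using key (MvPolynomial.X i)

instance AdicCompletion.isNoetherianRing {T : Type*} [CommRing T] [IsNoetherianRing T]
    (J : Ideal T) : IsNoetherianRing (AdicCompletion J T) := by
  obtain ⟨n, v, hv⟩ := Submodule.fg_iff_exists_fin_generating_family.mp
    (IsNoetherian.noetherian J)
  have hJ : J.FG := IsNoetherian.noetherian J
  have hc : IsAdicComplete (J.map (algebraMap T (AdicCompletion J T))) (AdicCompletion J T) :=
    (IsAdicComplete.map_algebraMap_iff ..).mpr (AdicCompletion.isAdicComplete hJ)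
  have hvJ : ∀ i, v i ∈ J := fun i => hv ▸ Submodule.subset_span ⟨i, rfl⟩
  obtain ⟨G, hG1, hG2⟩ := MvPowerSeries.exists_ringHom_extension
    (J.map (algebraMap T (AdicCompletion J T))) (algebraMap T (AdicCompletion J T))
    (fun i => algebraMap T _ (v i)) (fun i => Ideal.mem_map_of_mem _ (hvJ i))
  have hmap : (Ideal.span (Set.range (MvPowerSeries.X (σ := Fin n) (R := T)))).map G =
      J.map (algebraMap T (AdicCompletion J T)) := by
    have hJv : J.map (algebraMap T (AdicCompletion J T)) =
        (Ideal.span (Set.range v)).map (algebraMap T (AdicCompletion J T)) :=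
      congrArg (Ideal.map _) hv.symm
    rw [hJv, Ideal.map_span, Ideal.map_span, ← Set.range_comp, ← Set.range_comp]
    congr 2
    ext i
    simp [hG2]
  have : IsHausdorff ((Ideal.span (Set.range (MvPowerSeries.X (σ := Fin n) (R := T)))).map G)
      (AdicCompletion J T) := by
    rw [hmap]; infer_instance
  apply isNoetherianRing_of_surjective _ _ G
  apply surjective_of_mk_map_comp_surjective
    (I := (Ideal.span (Set.range (MvPowerSeries.X (σ := Fin n) (R := T)))))
  intro y
  obtain ⟨y, rfl⟩ := Ideal.Quotient.mk_surjective y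
  obtain ⟨t, ht⟩ := Ideal.Quotient.mk_surjective (evalOneₐ J y)
  refine ⟨MvPowerSeries.C t, ?_⟩
  rw [RingHom.comp_apply, hG1, Ideal.Quotient.eq, hmap, ← ker_evalOneₐ_eq_map _ hJ]
  rw [RingHom.mem_ker]
  simp [← ht]

namespace PowerSeries

variable {A : Type*} [CommRing A]

/-- The ideal of power series whose `i`-th coefficient lies in `J ^ (n - i)`. -/
def coeffFiltration (J : Ideal A) (n : ℕ) : Ideal A⟦X⟧ where
  carrier := {f | ∀ i, coeff i f ∈ J ^ (n - i)}
  add_mem' := fun hf hg i => by simpa using add_mem (hf i) (hg i)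
  zero_mem' := fun i => by simp
  smul_mem' := fun f g hg i => by
    rw [smul_eq_mul, coeff_mul]
    refine Ideal.sum_mem _ fun p hp => Ideal.mul_mem_left _ _ ?_
    have := Finset.HasAntidiagonal.mem_antidiagonal.mp hp
    exact Ideal.pow_le_pow_right (by omega) (hg p.2)

theorem mem_coeffFiltration {J : Ideal A} {n : ℕ} {f : A⟦X⟧} :
    f ∈ coeffFiltration J n ↔ ∀ i, coeff i f ∈ J ^ (n - i) := Iff.rfl

theorem pow_eq_coeffFiltration (J : Ideal A) (n : ℕ) :
    (J.map C ⊔ Ideal.span {X}) ^ n = coeffFiltration J n := by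
  apply le_antisymm
  · induction n with
    | zero => intro f _ i; simp
    | succ n ih =>
      have h1 : J.map C ⊔ Ideal.span {X} ≤ coeffFiltration J 1 := by
        rw [sup_le_iff, Ideal.map_le_iff_le_comap, Ideal.span_le, Set.singleton_subset_iff]
        constructor
        · intro a ha i
          rw [coeff_C]
          split_ifs with h
          · simpa [h] using ha
          · simp
        · intro i
          rw [coeff_X]
          split_ifs with h
          · simp [h]
          · simp
      rw [pow_succ]
      refine (Ideal.mul_mono ih h1).trans (Ideal.mul_le.mpr fun f hf g hg i => ?_)
      rw [coeff_mul]
      refine Ideal.sum_mem _ fun p hp => ?_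
      have := Finset.HasAntidiagonal.mem_antidiagonal.mp hp
      have h2 := Ideal.mul_mem_mul (hf p.1) (hg p.2)
      rw [← pow_add] at h2
      exact Ideal.pow_le_pow_right (by omega) h2
  · induction n with
    | zero => simp
    | succ n ih =>
      intro f hf
      rw [eq_X_mul_shift_add_const f, pow_succ']
      refine add_mem (Ideal.mul_mem_mul (Ideal.mem_sup_right (Ideal.mem_span_singleton_self X))
        (ih fun i => ?_)) ?_
      · simpa [Nat.add_sub_add_right] using hf (i + 1)
      · rw [← pow_succ']
        apply Ideal.pow_right_mono le_sup_left
        rw [← Ideal.map_pow]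
        exact Ideal.mem_map_of_mem _ (by simpa using hf 0)

theorem isAdicComplete_sup (J : Ideal A) [IsAdicComplete J A] :
    IsAdicComplete (J.map C ⊔ Ideal.span {X}) A⟦X⟧ where
  haus' f hf := by
    ext i
    rw [map_zero]
    refine IsHausdorff.haus (I := J) inferInstance _ fun k => ?_
    have := hf (k + i)
    rw [SModEq.sub_mem, smul_eq_mul, Ideal.mul_top, sub_zero, pow_eq_coeffFiltration] at this
    rw [SModEq.sub_mem, smul_eq_mul, Ideal.mul_top, sub_zero]
    simpa using this i
  prec' f hf := by
    have key : ∀ {m n}, m ≤ n → ∀ i, coeff i (f m) - coeff i (f n) ∈ J ^ (m - i) := by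
      intro m n hmn i
      have := hf hmn
      rw [SModEq.sub_mem, smul_eq_mul, Ideal.mul_top, pow_eq_coeffFiltration] at this
      simpa using this i
    have : ∀ i, ∃ L : A, ∀ k, coeff i (f (k + i)) ≡ L [SMOD (J ^ k • ⊤ : Submodule A A)] := by
      intro i
      apply IsPrecomplete.prec inferInstance
      intro m n hmn
      rw [SModEq.sub_mem, smul_eq_mul, Ideal.mul_top]
      simpa using key (Nat.add_le_add_right hmn i) i
    choose L hL using this
    refine ⟨mk L, fun n => ?_⟩
    rw [SModEq.sub_mem, smul_eq_mul, Ideal.mul_top, pow_eq_coeffFiltration]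
    intro i
    rw [map_sub, coeff_mk]
    by_cases h : i ≤ n
    · obtain ⟨k, rfl⟩ := Nat.exists_eq_add_of_le' h
      have := hL i k
      rw [SModEq.sub_mem, smul_eq_mul, Ideal.mul_top] at this
      simpa using this
    · simp [Nat.sub_eq_zero_of_le (le_of_not_ge h)]

end PowerSeries

section

open PowerSeries


/-- The elements of `L` whose `p ^ e`-th power comes from `S`. -/
def Algebra.rootSubalgebra (S L : Type*) [CommRing S] [CommRing L] [Algebra S L] (p : ℕ)
    [ExpChar L p] (e : ℕ) : Subalgebra S L where
  carrier := {b | ∃ s : S, b ^ p ^ e = algebraMap S L s}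
  mul_mem' := by
    rintro a b ⟨s, hs⟩ ⟨t, ht⟩
    exact ⟨s * t, by rw [mul_pow, hs, ht, map_mul]⟩
  add_mem' := by
    rintro a b ⟨s, hs⟩ ⟨t, ht⟩
    exact ⟨s + t, by rw [add_pow_expChar_pow, hs, ht, map_add]⟩
  algebraMap_mem' := fun s => ⟨s ^ p ^ e, by rw [map_pow]⟩

theorem PowerSeries.linearIndependent_of_quotient {A B ι : Type*} [CommRing A] [CommRing B]
    [IsDomain B] [Algebra A⟦X⟧ B] (J : Ideal B) (hX : algebraMap A⟦X⟧ B X ∈ J)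
    (hX0 : algebraMap A⟦X⟧ B X ≠ 0) (b : ι → B)
    (h : ∀ (t : Finset ι) (a : ι → A), ∑ i ∈ t, algebraMap A⟦X⟧ B (C (a i)) * b i ∈ J →
      ∀ i ∈ t, a i = 0) :
    LinearIndependent A⟦X⟧ b := by
  rw [linearIndependent_iff']
  intro t s hs i hi
  have key : ∀ n (s : ι → A⟦X⟧), ∑ i ∈ t, s i • b i = 0 → ∀ i ∈ t, X ^ n ∣ s i := by
    intro n
    induction n with
    | zero => simp
    | succ n ih =>
      intro s hs
      have h1 : ∀ i ∈ t, X ∣ s i := by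
        have := h t (fun i => constantCoeff (s i)) ?_
        · intro i hi
          exact X_dvd_iff.mpr (this i hi)
        · have h2 : ∑ i ∈ t, algebraMap A⟦X⟧ B (C (constantCoeff (s i)) - s i) * b i ∈ J := by
            refine J.sum_mem fun i _ => J.mul_mem_right _ ?_
            obtain ⟨g, hg⟩ : X ∣ C (constantCoeff (s i)) - s i := X_dvd_iff.mpr (by simp)
            rw [hg, map_mul]
            exact J.mul_mem_right _ hX
          simp only [map_sub, sub_mul, Finset.sum_sub_distrib] at h2
          simp only [Algebra.smul_def] at hs
          simpa [hs] using h2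
      choose! g hg using h1
      have h3 : ∑ i ∈ t, g i • b i = 0 := by
        have : algebraMap A⟦X⟧ B X * ∑ i ∈ t, g i • b i = 0 := by
          rw [Finset.mul_sum, ← hs]
          refine Finset.sum_congr rfl fun i hi => ?_
          conv_rhs => rw [hg i hi]
          rw [Algebra.smul_def, Algebra.smul_def, map_mul, mul_assoc]
        exact (mul_eq_zero.mp this).resolve_left hX0
      intro i hi
      rw [hg i hi, pow_succ']
      exact mul_dvd_mul_left X (ih g h3 i hi)
  ext n
  exact X_pow_dvd_iff.mp (key (n + 1) s hs i hi) n (Nat.lt_succ_self n)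

/-- Every `A`-module of elements, in a finite extension of the fraction field of `A`, whose
`p ^ e`-th powers are in `A`, is finitely generated. -/
def FiniteRoots (p : ℕ) (A : Type u) [CommRing A] : Prop :=
  ∀ (K L : Type u) [Field K] [Field L] [Algebra A K] [IsFractionRing A K] [Algebra A L]
    [Algebra K L] [IsScalarTower A K L] [FiniteDimensional K L] (e : ℕ) (M : Submodule A L),
    (∀ m ∈ M, ∃ a : A, m ^ p ^ e = algebraMap A L a) → M.FG

theorem FiniteRoots.of_field (p : ℕ) (k : Type u) [Field k] : FiniteRoots p k := by
  intro K L _ _ _ _ _ _ _ _ e M _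
  have : Module.Finite k K := Module.Finite.of_surjective (Algebra.linearMap k K)
    (IsFractionRing.surjective_iff_isField.mpr (Field.toIsField k))
  have : Module.Finite k L := Module.Finite.trans K L
  exact IsNoetherian.noetherian M

section

attribute [local instance] FractionRing.liftAlgebra

theorem FiniteRoots.finite_of_rank_lt {p : ℕ} {A : Type u} [CommRing A] [IsDomain A]
    (hA : FiniteRoots p A) {D : Type u} [CommRing D] [IsDomain D] [Algebra A D]
    [FaithfulSMul A D] (hp : p ≠ 0) (e : ℕ) (h : ∀ d : D, ∃ a : A, d ^ p ^ e = algebraMap A D a)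
    (hr : Module.rank A D < Cardinal.aleph0) : Module.Finite A D := by
  have : Algebra.IsIntegral A D := ⟨fun d => by
    obtain ⟨a, ha⟩ := h d
    refine .of_pow (n := p ^ e) (by positivity) ?_
    rw [ha]
    exact isIntegral_algebraMap⟩
  have hfd : FiniteDimensional (FractionRing A) (FractionRing D) := by
    refine Module.rank_lt_aleph0_iff.mp ?_
    rw [Algebra.IsAlgebraic.rank_fractionRing]
    exact hr
  have := hA (FractionRing A) (FractionRing D) e
    (LinearMap.range (IsScalarTower.toAlgHom A D (FractionRing D)).toLinearMap) (by
      rintro _ ⟨d, rfl⟩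
      obtain ⟨a, ha⟩ := h d
      exact ⟨a, by simp [← map_pow, ha, ← IsScalarTower.algebraMap_apply]⟩)
  rw [← Module.Finite.iff_fg] at this
  refine Module.Finite.equiv (LinearEquiv.ofInjective
    (IsScalarTower.toAlgHom A D (FractionRing D)).toLinearMap ?_).symm
  exact IsFractionRing.injective D (FractionRing D)

end

theorem PowerSeries.finite_of_finite_mod {A B : Type*} [CommRing A] [CommRing B]
    [Algebra A⟦X⟧ B] [IsHausdorff (Ideal.span {X} : Ideal A⟦X⟧) B] (y : B) (q : ℕ)
    (hy : y ^ q = algebraMap A⟦X⟧ B X) {n : ℕ} (b : Fin n → B)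
    (hb : ∀ c : B, ∃ a : Fin n → A, y ∣ c - ∑ i, algebraMap A⟦X⟧ B (C (a i)) * b i) :
    Module.Finite A⟦X⟧ B := by
  let N : Submodule A⟦X⟧ B :=
    Submodule.span A⟦X⟧ (Set.range fun ij : Fin n × Fin q => b ij.1 * y ^ (ij.2 : ℕ))
  have hN : N.FG := Submodule.fg_span (Set.finite_range _)
  have hstep : ∀ j ≤ q, ∀ c : B, ∃ m ∈ N, y ^ j ∣ c - m := by
    intro j
    induction j with
    | zero => exact fun _ c => ⟨0, N.zero_mem, by simp⟩
    | succ j ih =>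
      intro hj c
      obtain ⟨m, hm, d, hd⟩ := ih (by omega) c
      obtain ⟨a, d', hd'⟩ := hb d
      refine ⟨m + ∑ i, (C (a i) : A⟦X⟧) • (b i * y ^ j), N.add_mem hm (N.sum_mem fun i _ =>
        N.smul_mem _ (Submodule.subset_span ⟨(i, ⟨j, hj⟩), rfl⟩)), d', ?_⟩
      have : ∑ i, (C (a i) : A⟦X⟧) • (b i * y ^ j) =
          y ^ j * ∑ i, algebraMap A⟦X⟧ B (C (a i)) * b i := by
        rw [Finset.mul_sum]
        refine Finset.sum_congr rfl fun i _ => ?_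
        rw [Algebra.smul_def]
        ring
      rw [this, ← sub_sub, hd, ← mul_sub, hd', pow_succ, mul_assoc]
  have hNtop : N ⊔ (Ideal.span {X} : Ideal A⟦X⟧) • ⊤ = ⊤ := by
    rw [eq_top_iff]
    intro c _
    obtain ⟨m, hm, d, hd⟩ := hstep q le_rfl c
    rw [hy, sub_eq_iff_eq_add'] at hd
    rw [hd, ← Algebra.smul_def]
    exact Submodule.add_mem_sup hm
      (Submodule.smul_mem_smul (Ideal.mem_span_singleton_self X) trivial)
  have := Module.Finite.of_isPrecomplete_of_sup_eq_top (Ideal.span {X} : Ideal A⟦X⟧) N hN hNtop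
  exact Module.finite_def.mpr (this ▸ hN)

theorem PowerSeries.isHausdorff_of_ringHom {A B : Type*} [CommRing A] [CommRing B]
    [Algebra A⟦X⟧ B] (φ : B →+* A⟦X⟧) (hφ : Function.Injective φ)
    (hX : X ∣ φ (algebraMap A⟦X⟧ B X)) : IsHausdorff (Ideal.span {X} : Ideal A⟦X⟧) B := by
  refine ⟨fun c hc => ?_⟩
  rw [← map_eq_zero_iff φ hφ]
  ext i
  have h1 := hc (i + 1)
  rw [SModEq.sub_mem, sub_zero, Ideal.span_singleton_pow, Ideal.smul_top_eq_map,
    Ideal.map_span, Set.image_singleton, Submodule.restrictScalars_mem,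
    Ideal.mem_span_singleton] at h1
  obtain ⟨g, rfl⟩ := h1
  refine X_pow_dvd_iff.mp ?_ i (Nat.lt_succ_self i)
  rw [map_mul, map_pow, map_pow]
  exact (pow_dvd_pow_of_dvd hX _).mul_right _

/-- The key case of Tate's finiteness theorem for power series rings. -/
theorem FiniteRoots.finite_of_ringHom {p : ℕ} {A : Type u} [CommRing A] [IsDomain A]
    (hA : FiniteRoots p A) {B : Type u} [CommRing B] [IsDomain B] [Algebra A⟦X⟧ B]
    [FaithfulSMul A⟦X⟧ B] (hp : p ≠ 0) (e : ℕ) (φ : B →+* A⟦X⟧)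
    (hφ : ∀ b, b ^ p ^ e = algebraMap A⟦X⟧ B (φ b)) (y : B) (hy : φ y = X)
    (hdvd : ∀ b, X ∣ φ b → y ∣ b) (hr : Module.rank A⟦X⟧ B < Cardinal.aleph0) :
    Module.Finite A⟦X⟧ B := by
  have hinj := FaithfulSMul.algebraMap_injective A⟦X⟧ B
  have hq : p ^ e ≠ 0 := by positivity
  have hφinj : Function.Injective φ := by
    rw [injective_iff_map_eq_zero]
    intro b hb
    have := hφ b
    rw [hb, map_zero] at this
    exact pow_eq_zero_iff hq |>.mp this
  have hφalg : ∀ s, φ (algebraMap A⟦X⟧ B s) = s ^ p ^ e := by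
    intro s
    apply hinj
    rw [← hφ, map_pow]
  have hyX : y ^ p ^ e = algebraMap A⟦X⟧ B X := by rw [hφ, hy]
  have hX0 : algebraMap A⟦X⟧ B X ≠ 0 := (map_ne_zero_iff _ hinj).mpr X_ne_zero
  let χ : B →+* A := (constantCoeff (R := A)).comp φ
  have hJ : ∀ b, b ∈ RingHom.ker χ ↔ y ∣ b := by
    intro b
    constructor
    · intro h
      exact hdvd b (X_dvd_iff.mpr h)
    · rintro ⟨c, rfl⟩
      exact Ideal.mul_mem_right _ _ (by simp [χ, RingHom.mem_ker, hy])
  have hJp : (RingHom.ker χ).IsPrime := RingHom.ker_isPrime χ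
  have hXJ : algebraMap A⟦X⟧ B X ∈ RingHom.ker χ := by
    rw [hJ, ← hyX]
    exact dvd_pow_self y hq
  have hquot : ∀ b, b ^ p ^ e - algebraMap A⟦X⟧ B (C (χ b)) ∈ RingHom.ker χ := by
    intro b
    rw [hφ, ← map_sub]
    obtain ⟨g, hg⟩ : X ∣ φ b - C (χ b) := X_dvd_iff.mpr (by simp [χ])
    rw [hg, map_mul]
    exact Ideal.mul_mem_right _ _ hXJ
  have hCinj : ∀ a, algebraMap A⟦X⟧ B (C a) ∈ RingHom.ker χ → a = 0 := by
    intro a ha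
    have h5 : constantCoeff (φ (algebraMap A⟦X⟧ B (C a))) = 0 := ha
    rw [hφalg, map_pow, constantCoeff_C] at h5
    exact pow_eq_zero_iff hq |>.mp h5
  generalize hJdef : RingHom.ker χ = J at *
  let ψ : A →+* B ⧸ J := ((Ideal.Quotient.mk J).comp (algebraMap A⟦X⟧ B)).comp C
  let : Algebra A (B ⧸ J) := ψ.toAlgebra
  have hψ : ∀ a, algebraMap A (B ⧸ J) a = Ideal.Quotient.mk J (algebraMap A⟦X⟧ B (C a)) :=
    fun a => rfl
  have hfaith : FaithfulSMul A (B ⧸ J) := by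
    rw [faithfulSMul_iff_algebraMap_injective, injective_iff_map_eq_zero]
    intro a ha
    exact hCinj a (Ideal.Quotient.eq_zero_iff_mem.mp ha)
  have hrank : Module.rank A (B ⧸ J) < Cardinal.aleph0 := by
    obtain ⟨n, hn⟩ := Cardinal.lt_aleph0.mp hr
    refine (rank_le (n := n) fun s hs => ?_).trans_lt Cardinal.natCast_lt_aleph0
    choose b hb using fun i : s => Ideal.Quotient.mk_surjective (i : B ⧸ J)
    have := PowerSeries.linearIndependent_of_quotient J hXJ hX0 b (by
      intro t a ha
      rw [linearIndependent_iff'] at hs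
      refine hs t a ?_
      rw [← Ideal.Quotient.eq_zero_iff_mem, map_sum] at ha
      rw [← ha]
      refine Finset.sum_congr rfl fun i _ => ?_
      rw [map_mul, hb, Algebra.smul_def, hψ])
    have := this.cardinal_le_rank
    rw [hn] at this
    simpa using this
  have hfin : Module.Finite A (B ⧸ J) := by
    refine hA.finite_of_rank_lt hp e (fun d => ?_) hrank
    obtain ⟨b, rfl⟩ := Ideal.Quotient.mk_surjective d
    refine ⟨χ b, ?_⟩
    rw [← map_pow, ← sub_eq_zero, hψ, ← map_sub]
    exact Ideal.Quotient.eq_zero_iff_mem.mpr (hquot b)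
  obtain ⟨n, v, hv⟩ := Submodule.fg_iff_exists_fin_generating_family.mp
    (Module.finite_def.mp hfin)
  choose b hb using fun i : Fin n => Ideal.Quotient.mk_surjective (v i)
  have := PowerSeries.isHausdorff_of_ringHom φ hφinj (by rw [hφalg]; exact dvd_pow_self X hq)
  refine PowerSeries.finite_of_finite_mod y (p ^ e) hyX b fun c => ?_
  have : Ideal.Quotient.mk J c ∈ Submodule.span A (Set.range v) := by rw [hv]; trivial
  obtain ⟨a, ha⟩ := (Submodule.mem_span_range_iff_exists_fun A).mp this
  refine ⟨a, (hJ _).mp ?_⟩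
  rw [← Ideal.Quotient.eq_zero_iff_mem, map_sub, ← ha, map_sum, sub_eq_zero]
  refine Finset.sum_congr rfl fun i _ => ?_
  rw [map_mul, hb, Algebra.smul_def, hψ]

end

section

open PowerSeries

theorem FiniteRoots.rootSubalgebra_finite {p : ℕ} [Fact p.Prime] {A : Type u} [CommRing A]
    [IsDomain A] (hA : FiniteRoots p A) (K L : Type u) [Field K] [Field L] [Algebra A⟦X⟧ K]
    [IsFractionRing A⟦X⟧ K] [Algebra A⟦X⟧ L] [Algebra K L] [IsScalarTower A⟦X⟧ K L]
    [FiniteDimensional K L] [CharP L p] (e : ℕ) (y : L) (hy : y ^ p ^ e = algebraMap A⟦X⟧ L X) :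
    Module.Finite A⟦X⟧ (Algebra.rootSubalgebra A⟦X⟧ L p e) := by
  have hinj : Function.Injective (algebraMap A⟦X⟧ L) := by
    rw [IsScalarTower.algebraMap_eq A⟦X⟧ K L]
    exact (algebraMap K L).injective.comp (IsFractionRing.injective A⟦X⟧ K)
  let B := Algebra.rootSubalgebra A⟦X⟧ L p e
  choose f hf using fun b : B => b.2
  have hX0 : algebraMap A⟦X⟧ L X ≠ 0 := (map_ne_zero_iff _ hinj).mpr X_ne_zero
  have hp0 : p ≠ 0 := (Fact.out : p.Prime).ne_zero
  have hy0 : y ≠ 0 := by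
    rintro rfl
    rw [zero_pow (by positivity)] at hy
    exact hX0 hy.symm
  let φ : B →+* A⟦X⟧ :=
    { toFun := f
      map_one' := hinj (by rw [← hf]; simp)
      map_zero' := hinj (by rw [← hf]; simp [hp0])
      map_mul' := fun a b => hinj (by rw [← hf, map_mul, ← hf, ← hf]; simp [mul_pow])
      map_add' := fun a b => hinj (by
        rw [← hf, map_add, ← hf, ← hf]; simp [add_pow_expChar_pow]) }
  have hφ : ∀ b : B, (b : L) ^ p ^ e = algebraMap A⟦X⟧ L (φ b) := hf
  have hBL : Function.Injective (algebraMap A⟦X⟧ B) := by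
    intro a b hab
    exact hinj (congrArg Subtype.val hab)
  have : FaithfulSMul A⟦X⟧ B := (faithfulSMul_iff_algebraMap_injective _ _).mpr hBL
  refine hA.finite_of_ringHom hp0 e φ (fun b => Subtype.ext (hφ b)) ⟨y, X, hy⟩
    (hinj (by rw [← hφ]; exact hy)) ?_ ?_
  · intro b ⟨g, hg⟩
    have h1 : ((b : L) / y) ^ p ^ e = algebraMap A⟦X⟧ L g := by
      rw [div_pow, hy, hφ, hg, map_mul, mul_div_cancel_left₀ _ hX0]
    exact ⟨⟨b / y, g, h1⟩, Subtype.ext (mul_div_cancel₀ _ hy0).symm⟩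
  · refine (LinearMap.rank_le_of_injective B.val.toLinearMap Subtype.val_injective).trans_lt ?_
    rw [← IsFractionRing.rank_right_eq A⟦X⟧ (S := K) L]
    exact Module.rank_lt_aleph0_iff.mpr inferInstance

/-- **Tate's theorem** for purely inseparable extensions. -/
theorem FiniteRoots.powerSeries {p : ℕ} [Fact p.Prime] {A : Type u} [CommRing A]
    [IsDomain A] [IsNoetherianRing A] [CharP A p] (hA : FiniteRoots p A) :
    FiniteRoots p A⟦X⟧ := by
  intro K L _ _ _ _ _ _ _ _ e M hM
  have hinj : Function.Injective (algebraMap A⟦X⟧ L) := by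
    rw [IsScalarTower.algebraMap_eq A⟦X⟧ K L]
    exact (algebraMap K L).injective.comp (IsFractionRing.injective A⟦X⟧ K)
  have : CharP L p := charP_of_injective_ringHom (f := (algebraMap A⟦X⟧ L).comp C)
    (hinj.comp C_injective) p
  obtain ⟨y, hy⟩ := IsAlgClosed.exists_pow_nat_eq (algebraMap A⟦X⟧ (AlgebraicClosure L) X)
    (n := p ^ e) (pow_pos (Fact.out : p.Prime).pos e)
  let L' := IntermediateField.adjoin L {y}
  have : FiniteDimensional L L' :=
    IntermediateField.adjoin.finiteDimensional (Algebra.IsIntegral.isIntegral y)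
  have : FiniteDimensional K L' := FiniteDimensional.trans K L L'
  have : IsScalarTower A⟦X⟧ K L' := IsScalarTower.of_algebraMap_eq fun s => by
    rw [IsScalarTower.algebraMap_apply K L L', ← IsScalarTower.algebraMap_apply A⟦X⟧ K L,
      ← IsScalarTower.algebraMap_apply A⟦X⟧ L L']
  have : CharP L' p := charP_of_injective_algebraMap (algebraMap L L').injective p
  have hfin := hA.rootSubalgebra_finite K L' e ⟨y, IntermediateField.mem_adjoin_simple_self L y⟩
    (Subtype.ext hy)
  let g : L →ₗ[A⟦X⟧] L' := (IsScalarTower.toAlgHom A⟦X⟧ L L').toLinearMap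
  have hg : Function.Injective g := (algebraMap L L').injective
  refine Submodule.fg_of_fg_map_injective g hg ?_
  have hle : M.map g ≤ Subalgebra.toSubmodule (Algebra.rootSubalgebra A⟦X⟧ L' p e) := by
    rintro _ ⟨m, hm, rfl⟩
    obtain ⟨a, ha⟩ := hM m hm
    refine ⟨a, ?_⟩
    change (algebraMap L L' m) ^ p ^ e = _
    rw [← map_pow, ha, ← IsScalarTower.algebraMap_apply]
  have : IsNoetherian A⟦X⟧ (Subalgebra.toSubmodule (Algebra.rootSubalgebra A⟦X⟧ L' p e)) :=
    isNoetherian_of_isNoetherianRing_of_finite _ (Algebra.rootSubalgebra A⟦X⟧ L' p e)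
  exact Submodule.FG.of_le_of_isNoetherian hle

end

section

open PowerSeries

theorem IsIntegrallyClosed.dvd_of_forall_pow_dvd {A : Type*} [CommRing A] [IsDomain A]
    [IsNoetherianRing A] [IsIntegrallyClosed A] {a b c : A} (hb : b ≠ 0) (hc : c ≠ 0)
    (h : ∀ n, b ^ n ∣ c * a ^ n) : b ∣ a := by
  let K := FractionRing A
  have hb' : algebraMap A K b ≠ 0 := by simpa using hb
  have : IsAlmostIntegral A (algebraMap A K a / algebraMap A K b) := by
    refine ⟨c, mem_nonZeroDivisors_of_ne_zero hc, fun n => ?_⟩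
    obtain ⟨d, hd⟩ := h n
    refine ⟨d, ?_⟩
    rw [Algebra.smul_def, div_pow, mul_div_assoc', eq_div_iff (pow_ne_zero _ hb'), ← map_pow,
      ← map_pow, ← map_mul, ← map_mul, hd, mul_comm]
  rw [isAlmostIntegral_iff_isIntegral] at this
  obtain ⟨d, hd⟩ := IsIntegrallyClosed.isIntegral_iff.mp this
  refine ⟨d, IsFractionRing.injective A K ?_⟩
  rw [map_mul, hd, mul_div_cancel₀ _ hb']

theorem PowerSeries.exists_algebraMap_eq_of_isAlmostIntegral {A K : Type*} [CommRing A]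
    [IsDomain A] [IsNoetherianRing A] [IsIntegrallyClosed A] [Field K] [Algebra A K]
    [IsFractionRing A K] {h : K⟦X⟧} (hh : IsAlmostIntegral A⟦X⟧ h) :
    ∃ g : A⟦X⟧, algebraMap A⟦X⟧ K⟦X⟧ g = h := by
  have hAK := IsFractionRing.injective A K
  have halg : ∀ g : A⟦X⟧, algebraMap A⟦X⟧ K⟦X⟧ g = map (algebraMap A K) g := fun _ => rfl
  have hinj : Function.Injective (algebraMap A⟦X⟧ K⟦X⟧) := map_injective _ hAK
  have : FaithfulSMul A⟦X⟧ K⟦X⟧ := (faithfulSMul_iff_algebraMap_injective _ _).mpr hinj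
  have hconst : ∀ h : K⟦X⟧, IsAlmostIntegral A⟦X⟧ h →
      ∃ a : A, algebraMap A K a = constantCoeff h := by
    intro h hh
    refine IsIntegrallyClosed.isIntegral_iff.mp ?_
    obtain ⟨P, hP, hP'⟩ := hh.isIntegral
    refine ⟨P.map constantCoeff, hP.map _, ?_⟩
    have := congrArg (constantCoeff (R := K)) hP'
    rw [Polynomial.hom_eval₂, map_zero] at this
    have hcomp : (constantCoeff (R := K)).comp (algebraMap A⟦X⟧ K⟦X⟧) =
        (algebraMap A K).comp constantCoeff := RingHom.ext fun f => by
      rw [RingHom.comp_apply, halg, ← coeff_zero_eq_constantCoeff_apply, coeff_map]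
      simp
    rw [Polynomial.eval₂_map, ← hcomp]
    exact this
  have hshift : ∀ (n : ℕ) (h : K⟦X⟧), IsAlmostIntegral A⟦X⟧ h →
      ∃ a : A, algebraMap A K a = coeff n h := by
    intro n
    induction n with
    | zero => intro h hh; simpa using hconst h hh
    | succ n ih =>
      intro h hh
      obtain ⟨a, ha⟩ := hconst h hh
      obtain ⟨h', hh'⟩ : X ∣ h - C (algebraMap A K a) := X_dvd_iff.mpr (by simp [ha])
      have h1 : IsAlmostIntegral A⟦X⟧ (X * h') := by
        rw [← hh', ← map_C, ← halg, ← mem_completeIntegralClosure]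
        exact sub_mem hh (Subalgebra.algebraMap_mem _ _)
      have h2 : IsAlmostIntegral A⟦X⟧ h' := by
        obtain ⟨r, hr, hr'⟩ := h1
        refine ⟨r, hr, fun m => ?_⟩
        obtain ⟨s, hs⟩ := hr' m
        have : X ^ m ∣ s := by
          rw [X_pow_dvd_iff]
          intro i hi
          apply hAK
          rw [← coeff_map, ← halg, hs, map_zero, mul_pow, ← mul_smul_comm]
          exact X_pow_dvd_iff.mp (dvd_mul_right _ _) i hi
        obtain ⟨t, rfl⟩ := this
        refine ⟨t, mul_left_cancel₀ (pow_ne_zero m (X_ne_zero (R := K))) ?_⟩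
        rw [mul_pow] at hs
        rw [mul_smul_comm, ← hs, map_mul, halg (X ^ m)]
        simp
      obtain ⟨b, hb⟩ := ih h' h2
      refine ⟨b, ?_⟩
      rw [hb, ← coeff_succ_X_mul, ← hh']
      simp
  choose a ha using fun n => hshift n h hh
  exact ⟨mk a, by ext n; simp [halg, ha]⟩

instance PowerSeries.isIntegrallyClosed {A : Type*} [CommRing A] [IsDomain A]
    [IsNoetherianRing A] [IsIntegrallyClosed A] : IsIntegrallyClosed A⟦X⟧ := by
  let K := FractionRing A
  let L := FractionRing A⟦X⟧
  have halg : ∀ g : A⟦X⟧, algebraMap A⟦X⟧ K⟦X⟧ g = map (algebraMap A K) g := fun _ => rfl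
  have hinj : Function.Injective (algebraMap A⟦X⟧ K⟦X⟧) :=
    map_injective _ (IsFractionRing.injective A K)
  rw [isIntegrallyClosed_iff L]
  intro z hz
  obtain ⟨c, hc, hc'⟩ := hz.isAlmostIntegral
  have hc0 := nonZeroDivisors.ne_zero hc
  obtain ⟨f, g, hg, rfl⟩ := IsFractionRing.div_surjective (A := A⟦X⟧) z
  have hg0 := nonZeroDivisors.ne_zero hg
  have hgL : algebraMap A⟦X⟧ L g ≠ 0 := by simpa using hg0
  have key : ∀ n, ∃ d, g ^ n * d = c * f ^ n := by
    intro n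
    obtain ⟨d, hd⟩ := hc' n
    refine ⟨d, IsFractionRing.injective A⟦X⟧ L ?_⟩
    rw [map_mul, hd, map_pow, mul_smul_comm, ← mul_pow, mul_div_cancel₀ _ hgL, Algebra.smul_def,
      map_mul, map_pow]
  have hgK : algebraMap A⟦X⟧ K⟦X⟧ g ≠ 0 := (map_ne_zero_iff _ hinj).mpr hg0
  obtain ⟨h, hh⟩ : algebraMap A⟦X⟧ K⟦X⟧ g ∣ algebraMap A⟦X⟧ K⟦X⟧ f := by
    refine IsIntegrallyClosed.dvd_of_forall_pow_dvd hgK ((map_ne_zero_iff _ hinj).mpr hc0)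
      fun n => ?_
    obtain ⟨d, hd⟩ := key n
    rw [← map_pow, ← map_pow, ← map_mul, ← hd, map_mul]
    exact dvd_mul_right _ _
  obtain ⟨h, rfl⟩ := PowerSeries.exists_algebraMap_eq_of_isAlmostIntegral (A := A) (h := h) <| by
    refine ⟨c, hc, fun n => ?_⟩
    obtain ⟨d, hd⟩ := key n
    refine ⟨d, mul_left_cancel₀ (pow_ne_zero n hgK) ?_⟩
    rw [← map_pow, ← map_mul, hd, map_pow, mul_smul_comm, ← mul_pow, ← hh,
      Algebra.smul_def, map_mul, map_pow]
  refine ⟨h, ?_⟩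
  rw [eq_div_iff hgL, ← map_mul, mul_comm]
  congr 1
  apply hinj
  rw [hh, map_mul]

end

theorem IntermediateField.fixedField_top_isPurelyInseparable (K N : Type*) [Field K] [Field N]
    [Algebra K N] [Normal K N] :
    IsPurelyInseparable K (IntermediateField.fixedField (⊤ : Subgroup (N ≃ₐ[K] N))) := by
  classical
  rw [← le_perfectClosure_iff]
  intro x hx
  have hxi : IsIntegral K x := Algebra.IsIntegral.isIntegral x
  rw [mem_perfectClosure_iff_natSepDegree_eq_one,
    Polynomial.natSepDegree_eq_of_splits _ (Normal.splits inferInstance x), Finset.card_eq_one]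
  refine ⟨x, ?_⟩
  ext y
  rw [Multiset.mem_toFinset, Finset.mem_singleton, ← isConjRoot_iff_mem_minpoly_aroots hxi]
  constructor
  · intro h
    obtain ⟨σ, rfl⟩ := h.symm.exists_algEquiv
    exact hx ⟨σ, trivial⟩
  · rintro rfl
    exact rfl

theorem isIntegral_submodule_fg_of_isSeparable (A K L : Type*) [CommRing A] [IsDomain A]
    [IsNoetherianRing A] [IsIntegrallyClosed A] [Field K] [Field L]
    [Algebra A K] [IsFractionRing A K] [Algebra A L] [Algebra K L] [IsScalarTower A K L]
    [FiniteDimensional K L] [Algebra.IsSeparable K L] (M : Submodule A L)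
    (hM : ∀ m ∈ M, IsIntegral A m) : M.FG := by
  have : IsNoetherian A (integralClosure A L) := IsIntegralClosure.isNoetherian A K L _
  have : IsNoetherian A (Subalgebra.toSubmodule (integralClosure A L)) := this
  have hle : M ≤ Subalgebra.toSubmodule (integralClosure A L) := hM
  exact Submodule.FG.of_le_of_isNoetherian hle

theorem isIntegral_submodule_fg_of_isSeparable_of_finite (A C F N : Type*) [CommRing A]
    [IsNoetherianRing A] [CommRing C] [IsDomain C] [IsIntegrallyClosed C] [Algebra A C]
    [Module.Finite A C] [Field F] [Field N] [Algebra C F] [IsFractionRing C F] [Algebra A N]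
    [Algebra C N] [IsScalarTower A C N] [Algebra F N] [IsScalarTower C F N]
    [FiniteDimensional F N] [Algebra.IsSeparable F N] (M : Submodule A N)
    (hM : ∀ m ∈ M, IsIntegral A m) : M.FG := by
  have : IsNoetherianRing C := isNoetherian_of_tower A
    (isNoetherian_of_isNoetherianRing_of_finite A C)
  let D := Subalgebra.toSubmodule (integralClosure C N)
  have hD : D.FG := isIntegral_submodule_fg_of_isSeparable C F N _ fun m hm => hm
  have : Module.Finite C D := Module.Finite.iff_fg.mpr hD
  have : Module.Finite A D := Module.Finite.trans C D
  have : IsNoetherian A (D.restrictScalars A) := isNoetherian_of_isNoetherianRing_of_finite A D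
  have hle : M ≤ D.restrictScalars A := fun m hm => (hM m hm).tower_top
  exact Submodule.FG.of_le_of_isNoetherian hle

theorem FiniteRoots.fg_of_isIntegral {p : ℕ} [Fact p.Prime] {A : Type u} [CommRing A]
    [IsNoetherianRing A] [IsDomain A] [IsIntegrallyClosed A] [CharP A p] (hA : FiniteRoots p A)
    (K L : Type u) [Field K] [Field L]
    [Algebra A K] [IsFractionRing A K] [Algebra A L] [Algebra K L] [IsScalarTower A K L]
    [FiniteDimensional K L] (M : Submodule A L) (hM : ∀ m ∈ M, IsIntegral A m) : M.FG := by
  have : CharP K p := charP_of_injective_algebraMap (IsFractionRing.injective A K) p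
  let N := IntermediateField.normalClosure K L (AlgebraicClosure L)
  have : Normal K N := inferInstance
  have : FiniteDimensional K N := inferInstance
  have : IsScalarTower A K N := inferInstance
  let F := IntermediateField.fixedField (⊤ : Subgroup (N ≃ₐ[K] N))
  have : IsPurelyInseparable K F := IntermediateField.fixedField_top_isPurelyInseparable K N
  have : IsGalois F N := IsGalois.of_fixed_field N (⊤ : Subgroup (N ≃ₐ[K] N))
  let C := integralClosure A F
  have hCfg : (Subalgebra.toSubmodule C).FG := by
    refine hA K F (IsPurelyInseparable.exponent K F) _ fun m hm => ?_
    obtain ⟨x, hx⟩ := IsPurelyInseparable.exponent_def' K p m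
    have hxi : IsIntegral A x := by
      rw [← isIntegral_algebraMap_iff (algebraMap K F).injective, hx]
      exact IsIntegral.pow hm _
    obtain ⟨a, rfl⟩ := IsIntegrallyClosed.isIntegral_iff.mp hxi
    exact ⟨a, by rw [← hx, IsScalarTower.algebraMap_apply A K F]⟩
  have : Module.Finite A C := Module.Finite.iff_fg.mpr hCfg
  have : IsFractionRing C F := integralClosure.isFractionRing_of_finite_extension K F
  have : IsIntegrallyClosed C := integralClosure.isIntegrallyClosedOfFiniteExtension K
  have : IsScalarTower A L N := IsScalarTower.of_algebraMap_eq fun a => by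
    rw [IsScalarTower.algebraMap_apply A K L, ← IsScalarTower.algebraMap_apply K L N,
      ← IsScalarTower.algebraMap_apply A K N]
  have : IsScalarTower A F N := IsScalarTower.of_algebraMap_eq fun a => by
    rw [IsScalarTower.algebraMap_apply A K F, ← IsScalarTower.algebraMap_apply K F N,
      ← IsScalarTower.algebraMap_apply A K N]
  have : IsScalarTower A C N := IsScalarTower.of_algebraMap_eq fun a => by
    rw [IsScalarTower.algebraMap_apply C F N, ← IsScalarTower.algebraMap_apply A C F,
      ← IsScalarTower.algebraMap_apply A F N]
  let g : L →ₗ[A] N := (IsScalarTower.toAlgHom A L N).toLinearMap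
  refine Submodule.fg_of_fg_map_injective g (algebraMap L N).injective ?_
  refine isIntegral_submodule_fg_of_isSeparable_of_finite A C F N _ ?_
  rintro _ ⟨m, hm, rfl⟩
  exact (hM m hm).map (IsScalarTower.toAlgHom A L N)

instance MvPowerSeries.isDomain {σ R : Type*} [CommRing R] [IsDomain R] :
    IsDomain (MvPowerSeries σ R) :=
  NoZeroDivisors.to_isDomain _

theorem FiniteRoots.of_ringEquiv {p : ℕ} {A B : Type u} [CommRing A] [CommRing B] (f : A ≃+* B)
    (hA : FiniteRoots p A) : FiniteRoots p B := by
  intro K L _ _ _ _ _ _ _ _ e M hM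
  let : Algebra A B := f.toRingHom.toAlgebra
  let : Algebra A K := ((algebraMap B K).comp f.toRingHom).toAlgebra
  let : Algebra A L := ((algebraMap B L).comp f.toRingHom).toAlgebra
  have : IsScalarTower A B L := .of_algebraMap_eq fun _ => rfl
  have : IsScalarTower A K L := .of_algebraMap_eq fun a =>
    IsScalarTower.algebraMap_apply B K L (f a)
  have : IsFractionRing A K := by
    have := IsLocalization.isLocalization_of_base_ringEquiv (nonZeroDivisors B) K f.symm
    have h : (nonZeroDivisors B).map f.symm = nonZeroDivisors A :=
      MulEquivClass.map_nonZeroDivisors f.symm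
    rwa [h] at this
  obtain ⟨s, hs⟩ := hA K L e (M.restrictScalars A) fun m hm => by
    obtain ⟨b, hb⟩ := hM m hm
    exact ⟨f.symm b, by rw [hb]; exact congrArg _ (f.apply_symm_apply b).symm⟩
  refine ⟨s, le_antisymm (Submodule.span_le.mpr fun x hx => ?_) fun x hx => ?_⟩
  · exact (show x ∈ M.restrictScalars A from hs ▸ Submodule.subset_span hx)
  · exact Submodule.span_le_restrictScalars A B _ (hs ▸ (show x ∈ M.restrictScalars A from hx))

theorem FiniteRoots.mvPowerSeries (p : ℕ) [Fact p.Prime] (k : Type u) [Field k] [CharP k p]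
    (d : ℕ) : FiniteRoots p (MvPowerSeries (Fin d) k) := by
  induction d with
  | zero =>
    exact (FiniteRoots.of_field p k).of_ringEquiv
      (MvPowerSeries.isEmptyEquiv (σ := Fin 0) (R := k)).symm.toRingEquiv
  | succ d ih =>
    have : CharP (MvPowerSeries (Fin d) k) p :=
      charP_of_injective_ringHom (MvPowerSeries.C_injective (σ := Fin d) (R := k)) p
    exact ih.powerSeries.of_ringEquiv (MvPowerSeries.finSuccEquiv k d).symm.toRingEquiv

instance MvPowerSeries.isIntegrallyClosed_fin {V : Type*} [CommRing V] [IsDomain V]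
    [IsNoetherianRing V] [IsIntegrallyClosed V] (d : ℕ) :
    IsIntegrallyClosed (MvPowerSeries (Fin d) V) := by
  induction d with
  | zero =>
    exact IsIntegrallyClosed.of_equiv
      (MvPowerSeries.isEmptyEquiv (σ := Fin 0) (R := V)).symm.toRingEquiv
  | succ d ih =>
    exact IsIntegrallyClosed.of_equiv (MvPowerSeries.finSuccEquiv V d).symm.toRingEquiv

theorem MvPowerSeries.isIntegral_submodule_fg (V : Type u) [CommRing V] [IsDomain V]
    [IsNoetherianRing V] [IsIntegrallyClosed V] (hV : IsField V ∨ CharZero V) (d : ℕ)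
    (K L : Type u) [Field K] [Field L] [Algebra (MvPowerSeries (Fin d) V) K]
    [IsFractionRing (MvPowerSeries (Fin d) V) K] [Algebra (MvPowerSeries (Fin d) V) L]
    [Algebra K L] [IsScalarTower (MvPowerSeries (Fin d) V) K L]
    [FiniteDimensional K L] (M : Submodule (MvPowerSeries (Fin d) V) L)
    (hM : ∀ m ∈ M, IsIntegral (MvPowerSeries (Fin d) V) m) : M.FG := by
  have hVK : Function.Injective ((algebraMap (MvPowerSeries (Fin d) V) K).comp C) :=
    (IsFractionRing.injective (MvPowerSeries (Fin d) V) K).comp C_injective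
  by_cases h0 : CharZero V
  · have : CharZero K := charZero_of_injective_ringHom hVK
    exact isIntegral_submodule_fg_of_isSeparable _ K L M hM
  · let : Field V := (hV.resolve_right h0).toField
    obtain ⟨p, hp⟩ := CharP.exists V
    have hp0 : p ≠ 0 := by
      rintro rfl
      exact h0 (CharP.charP_to_charZero V)
    have : Fact p.Prime := ⟨(CharP.char_is_prime_or_zero V p).resolve_right hp0⟩
    have : CharP (MvPowerSeries (Fin d) V) p :=
      charP_of_injective_ringHom (MvPowerSeries.C_injective (σ := Fin d) (R := V)) p
    exact (FiniteRoots.mvPowerSeries p V d).fg_of_isIntegral K L M hM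

open IsLocalRing in
/-- A subring `D` of a local ring which has, at least, a part of the residue field `k` as residue
field and whose maximal ideal is generated by `p`. -/
structure IsCohenSubring {O : Type*} [CommRing O] [IsLocalRing O] (p : ℕ)
    (k : Subfield (ResidueField O)) (D : Subring O) : Prop where
  residue_mem : ∀ d ∈ D, residue O d ∈ k
  exists_eq_mul : ∀ d ∈ D, residue O d = 0 → ∃ e ∈ D, d = p * e

namespace IsCohenSubring

open IsLocalRing

variable {O : Type*} [CommRing O] [IsLocalRing O] {p : ℕ}
  {k : Subfield (ResidueField O)}

theorem bot (hp : p.Prime) (hpO : residue O p = 0) : IsCohenSubring p k (⊥ : Subring O) where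
  residue_mem d hd := by
    obtain ⟨n, rfl⟩ := Subring.mem_bot.mp hd
    simp
  exists_eq_mul d hd h := by
    obtain ⟨n, rfl⟩ := Subring.mem_bot.mp hd
    have : CharP (ResidueField O) p := by
      rw [map_natCast] at hpO
      exact (CharP.charP_iff_prime_eq_zero hp).mpr hpO
    rw [map_intCast, CharP.intCast_eq_zero_iff _ p] at h
    obtain ⟨m, rfl⟩ := h
    exact ⟨m, Subring.mem_bot.mpr ⟨m, rfl⟩, by push_cast; rfl⟩

theorem exists_maximal (hp : p.Prime) (hpO : residue O p = 0) :
    ∃ D : Subring O, Maximal (IsCohenSubring p k) D := by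
  obtain ⟨D, -, hD⟩ := zorn_le_nonempty₀ {D : Subring O | IsCohenSubring p k D} (by
    intro c hc hchain y hy
    have hdir : DirectedOn (· ≤ ·) c := hchain.directedOn
    refine ⟨sSup c, ⟨fun d hd => ?_, fun d hd h => ?_⟩, fun z hz => le_sSup hz⟩
    · obtain ⟨D, hD, hd⟩ := (Subring.mem_sSup_of_directedOn ⟨y, hy⟩ hdir).mp hd
      exact (hc hD).residue_mem d hd
    · obtain ⟨D, hD, hd⟩ := (Subring.mem_sSup_of_directedOn ⟨y, hy⟩ hdir).mp hd
      obtain ⟨e, he, rfl⟩ := (hc hD).exists_eq_mul d hd h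
      exact ⟨e, le_sSup hD he, rfl⟩) ⊥ (bot hp hpO)
  exact ⟨D, hD⟩

theorem exists_mul_eq_one {D : Subring O} (hD : Maximal (IsCohenSubring p k) D) {s : O}
    (hs : s ∈ D) (hs0 : residue O s ≠ 0) : ∃ t ∈ D, s * t = 1 := by
  have hu : ∀ s : O, residue O s ≠ 0 → IsUnit s := fun s h => by
    rwa [Ne, residue_eq_zero_iff, notMem_maximalIdeal] at h
  let D' : Subring O :=
    { carrier := {x | ∃ d ∈ D, ∃ s ∈ D, residue O s ≠ 0 ∧ s * x = d}
      mul_mem' := by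
        rintro x y ⟨d, hd, s, hs, hs0, h⟩ ⟨e, he, t, ht, ht0, h'⟩
        exact ⟨d * e, mul_mem hd he, s * t, mul_mem hs ht, by simp [hs0, ht0], by
          rw [← h, ← h']; ring⟩
      add_mem' := by
        rintro x y ⟨d, hd, s, hs, hs0, h⟩ ⟨e, he, t, ht, ht0, h'⟩
        exact ⟨t * d + s * e, add_mem (mul_mem ht hd) (mul_mem hs he), s * t, mul_mem hs ht,
          by simp [hs0, ht0], by rw [← h, ← h']; ring⟩
      one_mem' := ⟨1, one_mem D, 1, one_mem D, by simp, by simp⟩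
      zero_mem' := ⟨0, zero_mem D, 1, one_mem D, by simp, by simp⟩
      neg_mem' := by
        rintro x ⟨d, hd, s, hs, hs0, h⟩
        exact ⟨-d, neg_mem hd, s, hs, hs0, by rw [← h]; ring⟩ }
  have hle : D ≤ D' := fun d hd => ⟨d, hd, 1, one_mem D, by simp, by simp⟩
  have hD' : IsCohenSubring p k D' := by
    refine ⟨?_, ?_⟩
    · rintro x ⟨d, hd, s, hs, hs0, h⟩
      have h1 : residue O x = residue O d / residue O s := by
        rw [eq_div_iff hs0, ← map_mul, mul_comm, h]
      rw [h1]
      exact div_mem (hD.prop.residue_mem d hd) (hD.prop.residue_mem s hs)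
    · rintro x ⟨d, hd, s, hs, hs0, h⟩ hx
      obtain ⟨e, he, he'⟩ := hD.prop.exists_eq_mul d hd (by rw [← h, map_mul, hx, mul_zero])
      obtain ⟨u, rfl⟩ := hu s hs0
      refine ⟨↑u⁻¹ * e, ⟨e, he, u, hs, hs0, by simp⟩, ?_⟩
      rw [← u.isUnit.mul_right_inj, h, he', mul_left_comm, Units.mul_inv_cancel_left]
  have := hD.le_of_ge hD' hle
  obtain ⟨u, rfl⟩ := hu s hs0
  exact ⟨↑u⁻¹, this ⟨1, one_mem D, u, hs, hs0, by simp⟩, by simp⟩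

theorem exists_residue_eq {D : Subring O} (hD : Maximal (IsCohenSubring p k) D)
    (hO : ∀ (f : Polynomial O) (a : ResidueField O), f.Monic →
      Polynomial.eval a (f.map (residue O)) = 0 → ∃ α : O, f.eval α = 0 ∧ residue O α = a)
    {a : ResidueField O} (ha : a ∈ k) : ∃ d ∈ D, residue O d = a := by
  let ρ : D →+* ResidueField O := (residue O).comp D.subtype
  let P := RingHom.ker ρ
  have hP : ∀ d : D, d ∈ P ↔ residue O d = 0 := fun d => Iff.rfl
  have : P.IsMaximal := by
    have : P.IsPrime := RingHom.ker_isPrime ρ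
    rw [Ideal.Quotient.maximal_ideal_iff_isField_quotient]
    refine ⟨exists_pair_ne _, mul_comm, fun {x} hx => ?_⟩
    obtain ⟨⟨s, hs⟩, rfl⟩ := Ideal.Quotient.mk_surjective x
    rw [Ne, Ideal.Quotient.eq_zero_iff_mem, hP] at hx
    obtain ⟨t, ht, hst⟩ := exists_mul_eq_one hD hs hx
    exact ⟨Ideal.Quotient.mk P ⟨t, ht⟩, by
      rw [← map_mul, ← map_one (Ideal.Quotient.mk P)]; congr 1; exact Subtype.ext hst⟩
  let : Field (D ⧸ P) := Ideal.Quotient.field P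
  let ι : D ⧸ P →+* ResidueField O := RingHom.kerLift ρ
  let : Algebra (D ⧸ P) (ResidueField O) := ι.toAlgebra
  have hι : ∀ (α : O) (g : Polynomial D), residue O α = a →
      Polynomial.aeval a (g.map (Ideal.Quotient.mk P)) = residue O (Polynomial.aeval α g) := by
    intro α g hα
    rw [Polynomial.aeval_def, Polynomial.eval₂_map, Polynomial.aeval_def, Polynomial.hom_eval₂,
      hα]
    rfl
  obtain ⟨α, hα, key⟩ : ∃ α : O, residue O α = a ∧ ∀ g : Polynomial D, ∃ g' : Polynomial D,
      Polynomial.aeval α g' = Polynomial.aeval α g ∧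
      (Polynomial.aeval a (g'.map (Ideal.Quotient.mk P)) = 0 →
        g'.map (Ideal.Quotient.mk P) = 0) := by
    by_cases halg : IsIntegral (D ⧸ P) a
    · obtain ⟨f, hf, hfd, hfm⟩ := Polynomial.lifts_and_natDegree_eq_and_monic
        ((Polynomial.lifts_iff_coeff_lifts _).mpr fun n =>
          Ideal.Quotient.mk_surjective (I := P) ((minpoly (D ⧸ P) a).coeff n)) (minpoly.monic halg)
      have h1 : Polynomial.eval a ((f.map D.subtype).map (residue O)) = 0 := by
        have := minpoly.aeval (D ⧸ P) a
        rw [← hf, Polynomial.aeval_def, Polynomial.eval₂_map] at this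
        rw [Polynomial.map_map, Polynomial.eval_map]
        exact this
      obtain ⟨α, hα0, hα⟩ := hO _ a (hfm.map D.subtype) h1
      rw [Polynomial.eval_map] at hα0
      refine ⟨α, hα, fun g => ⟨g %ₘ f, ?_, fun h => ?_⟩⟩
      · conv_rhs => rw [← Polynomial.modByMonic_add_div g f]
        rw [map_add, map_mul]
        have : Polynomial.aeval α f = 0 := hα0
        rw [this, zero_mul, add_zero]
      · by_contra h0
        have h2 := minpoly.degree_le_of_ne_zero (D ⧸ P) a h0 h
        have h3 := Polynomial.degree_modByMonic_lt g hfm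
        have h4 := Polynomial.degree_map_le (p := g %ₘ f) (f := Ideal.Quotient.mk P)
        rw [← hf, hfm.degree_map] at h2
        exact absurd (h2.trans h4) h3.not_ge
    · obtain ⟨α, hα⟩ := residue_surjective a
      refine ⟨α, hα, fun g => ⟨g, rfl, fun h => ?_⟩⟩
      by_contra h0
      exact halg (IsAlgebraic.isIntegral ⟨_, h0, h⟩)
  let D' : Subring O := (Polynomial.aeval α : Polynomial D →ₐ[D] O).toRingHom.range
  have hle : D ≤ D' := fun d hd => ⟨Polynomial.C ⟨d, hd⟩, by simp; rfl⟩
  have hD' : IsCohenSubring p k D' := by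
    refine ⟨?_, ?_⟩
    · rintro _ ⟨g, rfl⟩
      change residue O (Polynomial.aeval α g) ∈ k
      rw [Polynomial.aeval_eq_sum_range, map_sum]
      refine sum_mem fun i _ => ?_
      rw [Algebra.smul_def, map_mul, map_pow, hα]
      exact mul_mem (hD.prop.residue_mem _ (g.coeff i).2) (pow_mem ha i)
    · rintro _ ⟨g, rfl⟩ h
      obtain ⟨g', hg', hg0⟩ := key g
      have h1 : residue O (Polynomial.aeval α g) = 0 := h
      rw [← hg', ← hι α g' hα] at h1
      have h2 := hg0 h1
      have h3 : ∀ n, ∃ e : D, g'.coeff n = p * e := fun n => by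
        have : g'.coeff n ∈ P := by
          rw [← Ideal.Quotient.eq_zero_iff_mem, ← Polynomial.coeff_map, h2, Polynomial.coeff_zero]
        obtain ⟨e, he, h⟩ := hD.prop.exists_eq_mul _ (g'.coeff n).2 this
        exact ⟨⟨e, he⟩, Subtype.ext h⟩
      obtain ⟨g'', rfl⟩ := Polynomial.C_dvd_iff_dvd_coeff (p : D) g' |>.mpr h3
      refine ⟨Polynomial.aeval α g'', ⟨g'', rfl⟩, ?_⟩
      change Polynomial.aeval α g = _
      rw [← hg']
      simp
  exact ⟨α, hD.le_of_ge hD' hle ⟨Polynomial.X, by simp⟩, hα⟩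

end IsCohenSubring

/-- A surjection of rings of characteristic `p` onto a field has a section if the `p`-th power
of each element of its kernel is zero. -/
theorem RingHom.exists_section_of_pow_char_eq_zero (p : ℕ) [hp : Fact p.Prime] {E k : Type*}
    [CommRing E] [CharP E p] [Field k] (π : E →+* k) (hπ : Function.Surjective π)
    (hker : ∀ e, π e = 0 → e ^ p = 0) : ∃ σ : k →+* E, π.comp σ = RingHom.id k := by
  have : CharP k p := (CharP.charP_iff_prime_eq_zero hp.out).mpr (by
    rw [← map_natCast π, CharP.cast_eq_zero, map_zero])
  obtain ⟨G, hG0, hG⟩ := zorn_le_nonempty₀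
      {G : Subring E | (frobenius E p).range ≤ G ∧ ∀ g ∈ G, π g = 0 → g = 0} (by
    intro c hc hchain y hy
    refine ⟨sSup c, ⟨(hc hy).1.trans (le_sSup hy), fun g hg h => ?_⟩, fun z hz => le_sSup hz⟩
    obtain ⟨D, hD, hg⟩ := (Subring.mem_sSup_of_directedOn ⟨y, hy⟩ hchain.directedOn).mp hg
    exact (hc hD).2 g hg h) (frobenius E p).range ⟨le_rfl, by
      rintro _ ⟨e, rfl⟩ h
      rw [frobenius_def] at h ⊢
      exact hker e (eq_zero_of_pow_eq_zero (n := p) (by rw [← map_pow, h]))⟩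
  have hinj : Function.Injective (π.comp G.subtype) :=
    (injective_iff_map_eq_zero _).mpr fun g hg => Subtype.ext (hG.prop.2 g g.2 hg)
  have hfrob : ∀ e : E, e ^ p ∈ G := fun e => hG0 ⟨e, rfl⟩
  have hp1 : p - 1 + 1 = p := Nat.sub_add_cancel hp.out.one_le
  have hfield : IsField G := by
    have : Nontrivial E := π.domain_nontrivial
    refine ⟨exists_pair_ne _, mul_comm, fun {g} hg => ?_⟩
    have hg' : π g ≠ 0 := fun h => hg (Subtype.ext (hG.prop.2 g g.2 h))
    obtain ⟨e, he⟩ := hπ (π g)⁻¹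
    refine ⟨g ^ (p - 1) * ⟨e ^ p, hfrob e⟩, hinj ?_⟩
    have : π g * (π g ^ (p - 1) * π e ^ p) = 1 := by
      rw [← mul_assoc, ← pow_succ', hp1, he, ← mul_pow, mul_inv_cancel₀ hg', one_pow]
    simpa using this
  have hsurj : Function.Surjective (π.comp G.subtype) := by
    intro x
    by_contra hx
    obtain ⟨e, rfl⟩ := hπ x
    let _ : Field G := hfield.toField
    let _ : Algebra G k := (π.comp G.subtype).toAlgebra
    let a : G := ⟨e ^ p, hfrob e⟩
    have hirr : Irreducible (Polynomial.X ^ p - Polynomial.C a) :=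
      X_pow_sub_C_irreducible_of_prime hp.out fun b hb => hx ⟨b, by
        have : π b ^ p = π e ^ p := by
          simpa [a] using congrArg (fun z : G => π z) hb
        exact frobenius_inj k p this⟩
    have hdvd : ∀ f : Polynomial G, Polynomial.aeval (π e) f = 0 →
        Polynomial.X ^ p - Polynomial.C a ∣ f := fun f hf => by
      rw [minpoly.eq_of_irreducible_of_monic hirr (x := π e) _
        (Polynomial.monic_X_pow_sub_C a hp.out.ne_zero)]
      · exact minpoly.dvd G _ hf
      · have : algebraMap G k a = π e ^ p := map_pow π e p
        simp [this]
    have hle : G ≤ (Polynomial.aeval e : Polynomial G →ₐ[G] E).toRingHom.range :=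
      fun d hd => ⟨Polynomial.C ⟨d, hd⟩, by simp; rfl⟩
    have := hG.le_of_ge ⟨hG0.trans hle, ?_⟩ hle
    · exact hx ⟨⟨e, this ⟨Polynomial.X, by simp⟩⟩, rfl⟩
    · rintro _ ⟨f, rfl⟩ hf
      obtain ⟨g, rfl⟩ := hdvd f (by
        rw [Polynomial.aeval_def]
        have : algebraMap G k = π.comp (algebraMap G E) := rfl
        rw [this, ← Polynomial.hom_eval₂]
        exact hf)
      have : algebraMap G E a = e ^ p := rfl
      simp [this]
  let σ := RingEquiv.ofBijective _ ⟨hinj, hsurj⟩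
  exact ⟨G.subtype.comp σ.symm.toRingHom, RingHom.ext fun x => σ.apply_symm_apply x⟩

theorem Algebra.FormallySmooth.of_surjective_intCast (p : ℕ) [Fact p.Prime] {F k : Type*}
    [CommRing F] [CharP F p] (hF : Function.Surjective (Int.cast : ℤ → F)) [Field k]
    [Algebra F k] : Algebra.FormallySmooth F k := by
  let f : MvPolynomial k F →ₐ[F] k := MvPolynomial.aeval _root_.id
  have hf : Function.Surjective f := fun x => ⟨MvPolynomial.X x, by simp [f]⟩
  let E := MvPolynomial k F ⧸ RingHom.ker f.toRingHom ^ 2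
  let π : E →ₐ[F] k := f.kerSquareLift
  have hπ : Function.Surjective π := fun x => by
    obtain ⟨y, rfl⟩ := hf x
    exact ⟨Ideal.Quotient.mk _ y, rfl⟩
  have : Nontrivial E := π.toRingHom.domain_nontrivial
  have : CharP E p := (CharP.charP_iff_prime_eq_zero Fact.out).mpr (by
    rw [← map_natCast (algebraMap F E), CharP.cast_eq_zero, map_zero])
  obtain ⟨σ, hσ⟩ := RingHom.exists_section_of_pow_char_eq_zero p π.toRingHom hπ fun e he => by
    obtain ⟨y, rfl⟩ := Ideal.Quotient.mk_surjective e
    have h2 : 2 ≤ p := (Fact.out : p.Prime).two_le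
    rw [← map_pow, Ideal.Quotient.eq_zero_iff_mem]
    exact Ideal.pow_le_pow_right h2 (Ideal.pow_mem_pow he p)
  exact Algebra.FormallySmooth.of_split f
    (AlgHom.mk σ fun r => by
      obtain ⟨n, rfl⟩ := hF r
      rw [map_intCast, map_intCast]
      exact map_intCast σ n)
    (AlgHom.ext fun x => congrArg (fun h => h x) hσ)

theorem Algebra.FormallySmooth.of_charZero (K L : Type*) [Field K] [CharZero K] [Field L]
    [Algebra K L] : Algebra.FormallySmooth K L := by
  obtain ⟨s, hs⟩ := exists_isTranscendenceBasis K L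
  have : Algebra.IsAlgebraic (IntermediateField.adjoin K (Set.range ((↑) : s → L))) L :=
    hs.isAlgebraic_field
  exact .of_algebraicIndependent_of_isSeparable hs.1

section

open IsLocalRing

theorem ValuationSubring.exists_root_of_residue {Ω : Type*} [Field Ω] [IsAlgClosed Ω]
    (O : ValuationSubring Ω) (f : Polynomial O) (a : ResidueField O) (hf : f.Monic)
    (h : Polynomial.eval a (f.map (residue O)) = 0) :
    ∃ α : O, f.eval α = 0 ∧ residue O α = a := by
  have hs := (IsAlgClosed.splits (f.map (algebraMap O Ω))).eq_prod_roots_of_monic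
    (hf.map (algebraMap O Ω))
  have hmem : ∀ x ∈ (f.map (algebraMap O Ω)).roots, x ∈ O := by
    intro x hx
    have hx' : IsIntegral O x := ⟨f, hf, ?_⟩
    · obtain ⟨y, rfl⟩ := IsIntegrallyClosed.isIntegral_iff.mp hx'
      exact y.2
    rw [← Polynomial.eval_map]
    exact (Polynomial.mem_roots'.mp hx).2
  generalize (f.map (algebraMap O Ω)).roots = s at *
  lift s to Multiset O using hmem
  have hf' : f = (s.map fun y => Polynomial.X - Polynomial.C y).prod := by
    apply Polynomial.map_injective (algebraMap O Ω) (IsFractionRing.injective O Ω)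
    rw [hs, Polynomial.map_multiset_prod, Multiset.map_map, Multiset.map_map]
    simp
  rw [hf', Polynomial.map_multiset_prod, Polynomial.eval_multiset_prod, Multiset.prod_eq_zero_iff,
    Multiset.map_map, Multiset.map_map, Multiset.mem_map] at h
  obtain ⟨y, hy, hy'⟩ := h
  refine ⟨y, ?_, ?_⟩
  · rw [hf', Polynomial.eval_multiset_prod, Multiset.prod_eq_zero_iff, Multiset.map_map,
      Multiset.mem_map]
    exact ⟨y, hy, by simp⟩
  · refine (sub_eq_zero.mp ?_).symm
    simpa using hy'

theorem IsLocalRing.exists_isLocalHom_valuationSubring (R : Type u) [CommRing R] [IsDomain R]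
    [IsLocalRing R] : ∃ (Ω : Type u) (_ : Field Ω) (_ : IsAlgClosed Ω) (O : ValuationSubring Ω)
      (g : R →+* O), Function.Injective g ∧ IsLocalHom g := by
  let Ω := AlgebraicClosure (FractionRing R)
  let f : R →+* Ω := (algebraMap (FractionRing R) Ω).comp (algebraMap R (FractionRing R))
  have hf : Function.Injective f :=
    (algebraMap (FractionRing R) Ω).injective.comp (IsFractionRing.injective R _)
  obtain ⟨O, hO, hloc⟩ := IsLocalRing.exists_factor_valuationRing f
  exact ⟨Ω, inferInstance, inferInstance, O, f.codRestrict O.toSubring hO,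
    fun a b h => hf (congrArg Subtype.val h), hloc⟩

/-- Every field of characteristic `p` is the quotient by `p` of a domain of characteristic zero. -/
theorem exists_charZero_surjective_ker_eq_span (p : ℕ) [Fact p.Prime] (k : Type u) [Field k]
    [CharP k p] : ∃ (D : Type u) (_ : CommRing D) (_ : IsDomain D) (_ : CharZero D)
      (π : D →+* k), Function.Surjective π ∧ RingHom.ker π = Ideal.span {(p : D)} := by
  let φ : MvPolynomial k ℤ →+* k := MvPolynomial.eval₂Hom (Int.castRingHom k) id
  have hφ : Function.Surjective φ := fun x => ⟨MvPolynomial.X x, by simp [φ]⟩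
  let q := RingHom.ker φ
  have : q.IsPrime := RingHom.ker_isPrime φ
  let R := Localization.AtPrime q
  have : IsDomain R := IsLocalization.isDomain_localization q.primeCompl_le_nonZeroDivisors
  obtain ⟨Ω, _, _, O, g, hg, hloc⟩ := IsLocalRing.exists_isLocalHom_valuationSubring R
  have : CharZero O := charZero_of_injective_ringHom (f := g.comp (algebraMap (MvPolynomial k ℤ) R))
    (hg.comp (IsLocalization.injective R q.primeCompl_le_nonZeroDivisors))
  let j : k →+* ResidueField O := (ResidueField.map g).comp
    ((Ideal.Quotient.lift q (algebraMap (MvPolynomial k ℤ) q.ResidueField) fun a ha => by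
      rwa [← RingHom.mem_ker, Ideal.ker_algebraMap_residueField]).comp
      (RingHom.quotientKerEquivOfSurjective hφ).symm.toRingHom)
  have hp : p.Prime := Fact.out
  have hpO : residue O p = 0 := by
    rw [map_natCast, ← map_natCast j, CharP.cast_eq_zero, map_zero]
  obtain ⟨D, hD⟩ := IsCohenSubring.exists_maximal (k := j.fieldRange) hp hpO
  let e : k ≃+* j.fieldRange := j.rangeRestrictFieldEquiv
  let π : D →+* k := e.symm.toRingHom.comp (((residue O).comp D.subtype).codRestrict
    j.fieldRange fun d => hD.prop.residue_mem d d.2)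
  have hπ : ∀ d : D, j (π d) = residue O d := fun d =>
    congrArg Subtype.val (e.apply_symm_apply ⟨residue O d, hD.prop.residue_mem d d.2⟩)
  refine ⟨D, inferInstance, inferInstance, ?_, π, fun x => ?_, ?_⟩
  · exact ⟨fun a b hab => by
      have := congrArg Subtype.val hab
      simpa using this⟩
  · obtain ⟨d, hd, hdx⟩ := IsCohenSubring.exists_residue_eq hD O.exists_root_of_residue
      (a := j x) ⟨x, rfl⟩
    exact ⟨⟨d, hd⟩, j.injective (by rw [hπ]; exact hdx)⟩
  · ext d
    rw [RingHom.mem_ker, Ideal.mem_span_singleton, ← map_eq_zero_iff j j.injective, hπ]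
    constructor
    · intro h
      obtain ⟨e, he, h'⟩ := hD.prop.exists_eq_mul d d.2 h
      exact ⟨⟨e, he⟩, Subtype.ext h'⟩
    · rintro ⟨e, rfl⟩
      have : residue O (p * e : O) = 0 := by rw [map_mul, hpO, zero_mul]
      exact this

end

/-- A ring which is complete for a principal maximal ideal, generated by a non-zero-divisor, is a
discrete valuation ring. -/
theorem IsAdicComplete.exists_isDiscreteValuationRing (R : Type*) [CommRing R] (p : R)
    [IsAdicComplete (Ideal.span {p}) R] (hmax : (Ideal.span {p}).IsMaximal)
    (hp : ∀ x, p * x = 0 → x = 0) : ∃ _ : IsDomain R, IsDiscreteValuationRing R := by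
  have hloc : IsLocalRing R := isLocalRing_of_isAdicComplete_maximal (Ideal.span {p})
  have hm : IsLocalRing.maximalIdeal R = Ideal.span {p} := (IsLocalRing.eq_maximalIdeal hmax).symm
  have hu : ∀ x, ¬ p ∣ x → IsUnit x := fun x hx => by
    by_contra h
    rw [← mem_nonunits_iff, ← IsLocalRing.mem_maximalIdeal, hm, Ideal.mem_span_singleton] at h
    exact hx h
  have hp' : ¬ IsUnit p := by
    rw [← mem_nonunits_iff, ← IsLocalRing.mem_maximalIdeal, hm]
    exact Ideal.mem_span_singleton_self p
  have hpow : ∀ n x, p ^ n * x = 0 → x = 0 := fun n => by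
    induction n with
    | zero => simp
    | succ n ih => exact fun x hx => ih x (hp _ (by rw [← mul_assoc, ← pow_succ', hx]))
  have key : ∀ x : R, x ≠ 0 → ∃ n, ∃ u : Rˣ, p ^ n * u = x := by
    intro x hx
    have : ∃ n, ¬ p ^ n ∣ x := by
      by_contra! h
      refine hx (IsHausdorff.haus' (I := Ideal.span {p}) x fun n => ?_)
      rw [SModEq.zero, smul_eq_mul, Ideal.mul_top, Ideal.span_singleton_pow,
        Ideal.mem_span_singleton]
      exact h n
    classical
    have h0 : Nat.find this ≠ 0 := fun h => by
      have := Nat.find_spec this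
      rw [h] at this
      simp at this
    obtain ⟨n, hn⟩ := Nat.exists_eq_succ_of_ne_zero h0
    obtain ⟨y, rfl⟩ : p ^ n ∣ x := not_not.mp (Nat.find_min this (m := n) (by omega))
    refine ⟨n, (hu y fun ⟨z, hz⟩ => Nat.find_spec this ⟨z, ?_⟩).unit, rfl⟩
    rw [hn, hz, Nat.succ_eq_add_one, pow_succ, mul_assoc]
  have hdom : IsDomain R := by
    have : NoZeroDivisors R := ⟨fun {a b} hab => by
      by_contra! h
      obtain ⟨n, u, rfl⟩ := key a h.1
      rw [mul_assoc] at hab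
      exact h.2 (by simpa using hpow n _ hab)⟩
    exact NoZeroDivisors.to_isDomain R
  refine ⟨hdom, IsDiscreteValuationRing.ofHasUnitMulPowIrreducibleFactorization
    ⟨p, ?_, fun {x} hx => ?_⟩⟩
  · refine (Ideal.span_singleton_prime fun h => one_ne_zero (hp 1 (by simp [h]))).mp
      hmax.isPrime |>.irreducible
  · obtain ⟨n, u, rfl⟩ := key x hx
    exact ⟨n, u, rfl⟩

theorem AdicCompletion.eq_zero_of_algebraMap_mul_eq_zero {D : Type*} [CommRing D] [IsDomain D]
    {p : D} (hp : p ≠ 0) (x : AdicCompletion (Ideal.span {p}) D)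
    (hx : algebraMap D _ p * x = 0) : x = 0 := by
  refine AdicCompletion.ext_evalₐ fun n => ?_
  obtain ⟨a, rfl⟩ := AdicCompletion.mk_surjective _ _ x
  have h := congrArg (AdicCompletion.evalₐ _ (n + 1)) hx
  rw [_root_.map_zero, map_mul, AlgHom.commutes, AdicCompletion.evalₐ_mk,
    Ideal.Quotient.algebraMap_eq,
    ← map_mul, Ideal.Quotient.eq_zero_iff_mem, Ideal.span_singleton_pow, pow_succ',
    Ideal.mem_span_singleton, mul_dvd_mul_iff_left hp] at h
  rw [_root_.map_zero, AdicCompletion.evalₐ_mk, ← AdicCompletion.Ideal.mk_eq_mk _ (Nat.le_succ n),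
    Ideal.Quotient.eq_zero_iff_mem, Ideal.span_singleton_pow, Ideal.mem_span_singleton]
  exact h

theorem Algebra.FormallySmooth.quotient_pow {Z D : Type*} [CommRing Z] [CommRing D] [Algebra Z D]
    [Module.Flat Z D] (J : Ideal Z) {n : ℕ} (hn : n ≠ 0)
    (h : Algebra.FormallySmooth (Z ⧸ J) (D ⧸ J.map (algebraMap Z D))) :
    Algebra.FormallySmooth (Z ⧸ J ^ n) (D ⧸ (J ^ n).map (algebraMap Z D)) := by
  induction n, Nat.one_le_iff_ne_zero.mpr hn using Nat.le_induction with
  | base => rwa [pow_one]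
  | succ n hn ih =>
    rw [← RingHom.formallySmooth_algebraMap]
    have hle : J ^ (n + 1) ≤ J ^ n := Ideal.pow_le_pow_right (Nat.le_succ n)
    refine RingHom.FormallySmooth.of_flat_of_ker_eq_map_of_square_zero _ ?_
      (Ideal.Quotient.factor hle) (Ideal.Quotient.factor (Ideal.map_mono hle)) _
      (Ideal.Quotient.factor_surjective _) (Ideal.Quotient.factor_surjective _) ?_ ?_ ?_
      (RingHom.formallySmooth_algebraMap.mpr (ih (by omega)))
    · rw [RingHom.flat_algebraMap_iff]
      exact Module.Flat.of_linearEquiv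
        (Algebra.TensorProduct.quotIdealMapEquivQuotTensor D (J ^ (n + 1))).toLinearEquiv
    · refine Ideal.Quotient.ringHom_ext (RingHom.ext fun x => rfl)
    · rw [Ideal.Quotient.factor_ker, ← Ideal.map_pow, ← pow_mul]
      exact Ideal.map_mk_eq_bot_of_le (Ideal.pow_le_pow_right (by omega))
    · rw [Ideal.Quotient.factor_ker, Ideal.Quotient.factor_ker, Ideal.map_map, Ideal.map_map]
      rfl

theorem Algebra.FormallySmooth.quotient_natCast_pow {D : Type*} [CommRing D] [IsDomain D]
    [CharZero D] (p : ℕ) [Fact p.Prime] (hD : (Ideal.span {(p : D)}).IsMaximal) {n : ℕ}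
    (hn : n ≠ 0) : Algebra.FormallySmooth (ℤ ⧸ Ideal.span {(p : ℤ)} ^ n)
      (D ⧸ (Ideal.span {(p : ℤ)} ^ n).map (algebraMap ℤ D)) := by
  have hp : Prime (p : ℤ) := Nat.prime_iff_prime_int.mp Fact.out
  have : (Ideal.span {(p : ℤ)}).IsMaximal :=
    PrincipalIdealRing.isMaximal_of_irreducible hp.irreducible
  have : ((Ideal.span {(p : ℤ)}).map (algebraMap ℤ D)).IsMaximal := by
    simpa [Ideal.map_span] using hD
  have : CharP (ℤ ⧸ Ideal.span {(p : ℤ)}) p :=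
    charP_of_injective_ringHom (f := (Int.quotientSpanNatEquivZMod p).symm.toRingHom)
      (Int.quotientSpanNatEquivZMod p).symm.injective p
  let _ := Ideal.Quotient.field ((Ideal.span {(p : ℤ)}).map (algebraMap ℤ D))
  exact Algebra.FormallySmooth.quotient_pow _ hn
    (Algebra.FormallySmooth.of_surjective_intCast p fun x => by
      obtain ⟨y, rfl⟩ := Ideal.Quotient.mk_surjective x
      exact ⟨y, by simp⟩)

theorem RingHom.exists_lift_of_natCast_pow_eq_zero {D : Type*} [CommRing D] [IsDomain D]
    [CharZero D] (p : ℕ) [Fact p.Prime] (hD : (Ideal.span {(p : D)}).IsMaximal) {n : ℕ}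
    (hn : n ≠ 0) {B C : Type*} [CommRing B] [CommRing C] (hB : (p : B) ^ n = 0) (h : B →+* C)
    (hs : Function.Surjective h) (hk : IsNilpotent (RingHom.ker h)) (g : D →+* C) :
    ∃ g' : D →+* B, h.comp g' = g := by
  have := Algebra.FormallySmooth.quotient_natCast_pow p hD hn
  set J : Ideal ℤ := Ideal.span {(p : ℤ)} ^ n with hJ
  have hJB : ∀ a ∈ J, Int.castRingHom B a = 0 := fun a ha => by
    rw [hJ, Ideal.span_singleton_pow, Ideal.mem_span_singleton] at ha
    obtain ⟨b, rfl⟩ := ha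
    simp [hB]
  have hJD : J.map (algebraMap ℤ D) ≤ RingHom.ker g := by
    rw [Ideal.map_le_iff_le_comap]
    intro a ha
    have := congrArg h (hJB a ha)
    simpa [RingHom.mem_ker] using this
  let _ : Algebra (ℤ ⧸ J) B := (Ideal.Quotient.lift J (Int.castRingHom B) hJB).toAlgebra
  let _ : Algebra (ℤ ⧸ J) C := (h.comp (algebraMap (ℤ ⧸ J) B)).toAlgebra
  have hext : ∀ {S : Type _} [CommRing S] (f g : ℤ ⧸ J →+* S), f = g := fun f g =>
    Ideal.Quotient.ringHom_ext (Subsingleton.elim _ _)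
  let hA : B →ₐ[ℤ ⧸ J] C := { h with commutes' := fun _ => rfl }
  let g₀ : (D ⧸ J.map (algebraMap ℤ D)) →+* C := Ideal.Quotient.lift _ g fun a ha => hJD ha
  let gA : (D ⧸ J.map (algebraMap ℤ D)) →ₐ[ℤ ⧸ J] C :=
    { g₀ with commutes' := fun r =>
        RingHom.congr_fun (hext (g₀.comp (algebraMap _ _)) (algebraMap _ _)) r }
  let l := Algebra.FormallySmooth.liftOfSurjective gA hA hs hk
  refine ⟨l.toRingHom.comp (Ideal.Quotient.mk _), RingHom.ext fun x => ?_⟩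
  exact Algebra.FormallySmooth.liftOfSurjective_apply gA hA hs hk _

/-- A domain of characteristic zero in which `p` generates a maximal ideal maps to a complete
local ring, lifting a given map modulo the maximal ideal. -/
theorem IsAdicComplete.exists_ringHom_lift_of_natCast_mem {D R : Type*} [CommRing D] [IsDomain D]
    [CharZero D] (p : ℕ) [Fact p.Prime] (hD : (Ideal.span {(p : D)}).IsMaximal) [CommRing R]
    (m : Ideal R) [IsAdicComplete m R] (hp : (p : R) ∈ m) (g : D →+* R ⧸ m) :
    ∃ G : D →+* R, (Ideal.Quotient.mk m).comp G = g := by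
  have key : ∀ n (f : D →+* R ⧸ m ^ (n + 1)), ∃ f' : D →+* R ⧸ m ^ (n + 1 + 1),
      (Ideal.Quotient.factorPow m (n + 1).le_succ).comp f' = f := fun n f => by
    refine RingHom.exists_lift_of_natCast_pow_eq_zero p hD (n := n + 1 + 1) (by omega) ?_ _
      (Ideal.Quotient.factor_surjective _) ⟨2, ?_⟩ f
    · rw [← map_natCast (Ideal.Quotient.mk _), ← map_pow, Ideal.Quotient.eq_zero_iff_mem]
      exact Ideal.pow_mem_pow hp _
    · rw [Ideal.Quotient.factor_ker, ← Ideal.map_pow, ← pow_mul]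
      exact Ideal.map_mk_eq_bot_of_le (Ideal.pow_le_pow_right (by omega))
  choose F hF using key
  have h1 : m ≤ m ^ (0 + 1) := by simp
  let f : ∀ n, D →+* R ⧸ m ^ (n + 1) := fun n =>
    Nat.rec ((Ideal.Quotient.factor h1).comp g) (fun n f => F n f) n
  have ha : StrictMono fun n : ℕ => n + 1 := fun a b h => by simpa using h
  have hf : ∀ {n}, (Ideal.Quotient.factorPow m (ha.monotone n.le_succ)).comp (f (n + 1)) = f n :=
    fun {n} => hF n (f n)
  refine ⟨IsAdicComplete.StrictMono.liftRingHom m ha f hf, RingHom.ext fun x => ?_⟩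
  have h := IsAdicComplete.StrictMono.mk_liftRingHom m ha f hf (n := 0) x
  obtain ⟨r, hr⟩ := Ideal.Quotient.mk_surjective (g x)
  have h' : f 0 x = Ideal.Quotient.mk (m ^ (0 + 1)) r := by
    change Ideal.Quotient.factor h1 (g x) = _
    rw [← hr, Ideal.Quotient.factor_mk]
  rw [h', Ideal.Quotient.mk_eq_mk_iff_sub_mem] at h
  rw [RingHom.comp_apply, ← hr, Ideal.Quotient.mk_eq_mk_iff_sub_mem]
  simpa using h

open IsLocalRing in
/-- A complete local domain has a coefficient ring, which is a field or a discrete valuation ring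
of mixed characteristic. -/
theorem IsLocalRing.exists_coefficientRing (R : Type u) [CommRing R] [IsDomain R] [IsLocalRing R]
    [IsAdicComplete (maximalIdeal R) R] :
    ∃ (V : Type u) (_ : CommRing V) (_ : IsDomain V) (_ : IsNoetherianRing V)
      (_ : IsIntegrallyClosed V) (_ : IsLocalRing V) (π : V) (φ : V →+* R),
      (IsField V ∨ CharZero V) ∧ maximalIdeal V = Ideal.span {π} ∧
      IsAdicComplete (maximalIdeal V) V ∧ (φ π = 0 → π = 0) ∧ φ π ∈ maximalIdeal R ∧
      Function.Surjective ((residue R).comp φ) := by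
  have hfield : ∀ (F : Type) [Field F] [Algebra F R]
        (_ : Algebra.FormallySmooth F (ResidueField R)),
      ∃ (V : Type u) (_ : CommRing V) (_ : IsDomain V) (_ : IsNoetherianRing V)
      (_ : IsIntegrallyClosed V) (_ : IsLocalRing V) (π : V) (φ : V →+* R),
      (IsField V ∨ CharZero V) ∧ maximalIdeal V = Ideal.span {π} ∧
      IsAdicComplete (maximalIdeal V) V ∧ (φ π = 0 → π = 0) ∧ φ π ∈ maximalIdeal R ∧
      Function.Surjective ((residue R).comp φ) := by
    intro F _ _ _
    obtain ⟨g, hg⟩ := Algebra.FormallySmooth.exists_mkₐ_comp_eq_of_isAdicComplete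
      (I := maximalIdeal R) (AlgHom.id F (ResidueField R))
    refine ⟨ResidueField R, inferInstance, inferInstance, inferInstance, inferInstance,
      inferInstance, 0, g.toRingHom, Or.inl (Field.toIsField _), ?_, ?_, fun _ => rfl, ?_,
      fun x => ⟨x, AlgHom.congr_fun hg x⟩⟩
    · rw [IsLocalRing.maximalIdeal_eq_bot]; simp
    · rw [IsLocalRing.maximalIdeal_eq_bot]; infer_instance
    · simp
  obtain ⟨p, hp⟩ := CharP.exists (ResidueField R)
  rcases CharP.char_is_prime_or_zero (ResidueField R) p with hprime | rfl
  · have : Fact p.Prime := ⟨hprime⟩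
    by_cases hpR : (p : R) = 0
    · have : CharP R p := (CharP.charP_iff_prime_eq_zero hprime).mpr hpR
      let _ : Algebra (ZMod p) R := ZMod.algebra R p
      exact hfield (ZMod p) (Algebra.FormallySmooth.of_surjective_intCast p
        ZMod.intCast_surjective)
    · obtain ⟨D, _, _, _, q, hq, hker⟩ :=
        exists_charZero_surjective_ker_eq_span p (ResidueField R)
      have hmax : (Ideal.span {(p : D)}).IsMaximal :=
        hker ▸ RingHom.ker_isMaximal_of_surjective q hq
      have hpm : (p : R) ∈ maximalIdeal R := by
        rw [← residue_eq_zero_iff, map_natCast, CharP.cast_eq_zero]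
      obtain ⟨g, hg⟩ := IsAdicComplete.exists_ringHom_lift_of_natCast_mem p hmax _ hpm q
      obtain ⟨G, hG⟩ := AdicCompletion.exists_ringHom_extension (Ideal.span {(p : D)})
        (maximalIdeal R) g (by simpa [Ideal.map_span, Ideal.span_le] using hpm)
      set V := AdicCompletion (Ideal.span {(p : D)}) D
      have hFG : (Ideal.span {(p : D)}).FG := ⟨{(p : D)}, by simp⟩
      have hmap : (Ideal.span {(p : D)}).map (algebraMap D V) = Ideal.span {(p : V)} := by
        simp [Ideal.map_span]
      have hVmax : (Ideal.span {(p : V)}).IsMaximal :=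
        hmap ▸ AdicCompletion.isMaximal_map_of_le _ _ le_rfl hFG
      have hVc : IsAdicComplete (Ideal.span {(p : V)}) V :=
        hmap ▸ AdicCompletion.isAdicComplete_self _ hFG
      have hnz : ∀ x : V, (p : V) * x = 0 → x = 0 := fun x hx =>
        AdicCompletion.eq_zero_of_algebraMap_mul_eq_zero (p := (p : D))
          (Nat.cast_ne_zero.mpr hprime.ne_zero) x (by simpa using hx)
      obtain ⟨_, _⟩ := IsAdicComplete.exists_isDiscreteValuationRing V (p : V) hVmax hnz
      have hm : maximalIdeal V = Ideal.span {(p : V)} := (IsLocalRing.eq_maximalIdeal hVmax).symm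
      have hGn : ∀ l : ℕ, G (l : V) = l := fun l => map_natCast G l
      have : CharZero V := by
        obtain ⟨l, hl⟩ := CharP.exists V
        rcases CharP.char_is_prime_or_zero V l with hl' | rfl
        · have h0 : (l : R) = 0 :=
            (hGn l).symm.trans ((congrArg G (CharP.cast_eq_zero V l)).trans (map_zero G))
          have hpl : p ∣ l := by
            rw [← CharP.cast_eq_zero_iff (ResidueField R) p, ← map_natCast (residue R), h0,
              map_zero]
          rw [← (Nat.prime_dvd_prime_iff_eq hprime hl').mp hpl] at h0
          exact absurd h0 hpR
        · exact CharP.charP_to_charZero V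
      refine ⟨V, inferInstance, inferInstance, inferInstance, inferInstance, inferInstance, p, G,
        Or.inr this, hm, hm ▸ hVc, fun h => absurd ((hGn p).symm.trans h) hpR, (hGn p).symm ▸ hpm,
        fun x => ?_⟩
      obtain ⟨d, rfl⟩ := hq x
      exact ⟨algebraMap D V d, by rw [RingHom.comp_apply, hG]; exact RingHom.congr_fun hg d⟩
  · have : CharZero (ResidueField R) := CharP.charP_to_charZero _
    let f : ℚ →+* R := IsLocalization.lift (M := nonZeroDivisors ℤ) (g := Int.castRingHom R)
      fun y => by
        rw [← residue_ne_zero_iff_isUnit]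
        simp
    let _ : Algebra ℚ R := f.toAlgebra
    exact hfield ℚ (@Algebra.FormallySmooth.of_charZero ℚ (ResidueField R) _ _ _
      (ResidueField.algebra R))

open IsLocalRing in
theorem PowerSeries.maximalIdeal_eq_sup {A : Type*} [CommRing A] [IsLocalRing A] :
    maximalIdeal (PowerSeries A) =
      (maximalIdeal A).map PowerSeries.C ⊔ Ideal.span {PowerSeries.X} := by
  have h : ∀ f : PowerSeries A, f ∈ maximalIdeal (PowerSeries A) ↔
      PowerSeries.constantCoeff f ∈ maximalIdeal A := fun f => by
    rw [mem_maximalIdeal, mem_nonunits_iff, PowerSeries.isUnit_iff_constantCoeff,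
      mem_maximalIdeal, mem_nonunits_iff]
  apply le_antisymm
  · intro f hf
    rw [PowerSeries.eq_X_mul_shift_add_const f, add_comm]
    exact Submodule.add_mem_sup (Ideal.mem_map_of_mem _ ((h f).mp hf))
      (Ideal.mul_mem_right _ _ (Ideal.mem_span_singleton_self _))
  · rw [sup_le_iff, Ideal.map_le_iff_le_comap, Ideal.span_singleton_le_iff_mem, h]
    exact ⟨fun a ha => by rw [Ideal.mem_comap, h]; simpa using ha, by simp⟩

open IsLocalRing in
theorem IsLocalRing.maximalIdeal_map_ringEquiv {A B : Type*} [CommRing A] [CommRing B]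
    [IsLocalRing A] [IsLocalRing B] (e : A ≃+* B) :
    (maximalIdeal A).map e = maximalIdeal B :=
  IsLocalRing.map_maximalIdeal_of_surjective (e : A →+* B) e.surjective

open IsLocalRing in
theorem MvPowerSeries.isAdicComplete_and_exists_span_eq_maximalIdeal {V : Type*} [CommRing V]
    [IsLocalRing V] [IsAdicComplete (maximalIdeal V) V] (s : Finset V)
    (hs : Ideal.span (s : Set V) = maximalIdeal V) (d : ℕ) :
    IsAdicComplete (maximalIdeal (MvPowerSeries (Fin d) V)) (MvPowerSeries (Fin d) V) ∧
      ∃ t : Finset (MvPowerSeries (Fin d) V), t.card ≤ s.card + d ∧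
        Ideal.span (t : Set (MvPowerSeries (Fin d) V)) =
          maximalIdeal (MvPowerSeries (Fin d) V) := by
  classical
  have transfer : ∀ {A B : Type _} [CommRing A] [CommRing B] [IsLocalRing A] [IsLocalRing B]
      (e : A ≃+* B) (n : ℕ), (IsAdicComplete (maximalIdeal A) A ∧ ∃ t : Finset A, t.card ≤ n ∧
        Ideal.span (t : Set A) = maximalIdeal A) → (IsAdicComplete (maximalIdeal B) B ∧
        ∃ t : Finset B, t.card ≤ n ∧ Ideal.span (t : Set B) = maximalIdeal B) := by
    rintro A B _ _ _ _ e n ⟨hA, t, ht, hst⟩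
    rw [← maximalIdeal_map_ringEquiv e]
    refine ⟨(IsAdicComplete.congr_ringEquiv _ e).mpr hA, t.image e,
      Finset.card_image_le.trans ht, ?_⟩
    rw [← hst, Ideal.map_span, Finset.coe_image]
  induction d with
  | zero =>
    exact transfer (MvPowerSeries.isEmptyEquiv (σ := Fin 0) (R := V)).symm.toRingEquiv _
      ⟨‹_›, s, le_rfl, hs⟩
  | succ d ih =>
    obtain ⟨hA, t, ht, hst⟩ := ih
    refine transfer (MvPowerSeries.finSuccEquiv V d).symm.toRingEquiv _ ⟨?_,
      insert PowerSeries.X (t.image PowerSeries.C), ?_, ?_⟩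
    · rw [PowerSeries.maximalIdeal_eq_sup]
      exact PowerSeries.isAdicComplete_sup _
    · have h1 := Finset.card_insert_le PowerSeries.X (t.image (PowerSeries.C))
      have h2 := Finset.card_image_le (s := t)
        (f := (PowerSeries.C : MvPowerSeries (Fin d) V →+* _))
      omega
    · rw [PowerSeries.maximalIdeal_eq_sup, ← hst, Ideal.map_span, Finset.coe_insert,
        Ideal.span_insert, sup_comm, Finset.coe_image]

theorem Algebra.ringKrullDim_le_of_isIntegral (T R : Type*) [CommRing T] [CommRing R] [Algebra T R]
    [Algebra.IsIntegral T R] : ringKrullDim R ≤ ringKrullDim T :=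
  Order.krullDim_le_of_strictMono (fun P => PrimeSpectrum.comap (algebraMap T R) P) fun P Q h => by
    have := Ideal.IsIntegral.comap_lt_comap (R := T) (I := P.asIdeal) (J := Q.asIdeal) h
    exact this

theorem Algebra.algebraMap_injective_of_ringKrullDim_le (T R : Type*) [CommRing T] [IsDomain T]
    [CommRing R] [Algebra T R] [Algebra.IsIntegral T R] [FiniteRingKrullDim R]
    (h : ringKrullDim T ≤ ringKrullDim R) : Function.Injective (algebraMap T R) := by
  rw [injective_iff_map_eq_zero]
  intro r hr
  by_contra hr0
  let _ : Algebra (T ⧸ RingHom.ker (algebraMap T R)) R :=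
    (RingHom.kerLift (algebraMap T R)).toAlgebra
  have : IsScalarTower T (T ⧸ RingHom.ker (algebraMap T R)) R := .of_algebraMap_eq fun x => rfl
  have : Algebra.IsIntegral (T ⧸ RingHom.ker (algebraMap T R)) R := .tower_top T
  have h1 := ringKrullDim_succ_le_of_surjective _
    (Ideal.Quotient.mk_surjective (I := RingHom.ker (algebraMap T R)))
    (mem_nonZeroDivisors_of_ne_zero hr0) (Ideal.Quotient.eq_zero_iff_mem.mpr hr)
  have h2 := Algebra.ringKrullDim_le_of_isIntegral (T ⧸ RingHom.ker (algebraMap T R)) R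
  have h3 : ringKrullDim R + 1 ≤ ringKrullDim R := (add_le_add_left h2 1).trans (h1.trans h)
  have h4 : ringKrullDim R ≠ ⊤ := ringKrullDim_ne_top
  have h5 : ringKrullDim R ≠ ⊥ := ringKrullDim_ne_bot
  lift ringKrullDim R to ℕ∞ using h5 with e he
  lift e to ℕ using (by rintro rfl; exact h4 rfl) with e
  norm_cast at h3
  omega

open IsLocalRing in
theorem IsLocalRing.exists_parameters (R : Type*) [CommRing R] [IsLocalRing R]
    [IsNoetherianRing R] : ∃ (d : ℕ) (x : Fin d → R), (∀ i, x i ∈ maximalIdeal R) ∧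
      (∃ N, maximalIdeal R ^ N ≤ Ideal.span (Set.range x)) ∧ d ≤ ringKrullDim R := by
  obtain ⟨s, hs, hcard⟩ :=
    (maximalIdeal R).exists_finset_card_eq_height_of_isNoetherianRing
  refine ⟨s.card, fun i => s.equivFin.symm i, fun i => ?_, ?_, ?_⟩
  · exact hs.1.2 (Ideal.subset_span (s.equivFin.symm i).2)
  · have hr : Set.range (fun i => (s.equivFin.symm i : R)) = s := by
      ext y
      exact ⟨fun ⟨i, hi⟩ => hi ▸ (s.equivFin.symm i).2, fun hy => ⟨s.equivFin ⟨y, hy⟩, by simp⟩⟩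
    rw [hr]
    refine Ideal.exists_pow_le_of_le_radical_of_fg ?_ (IsNoetherian.noetherian _)
    rw [Ideal.radical_eq_sInf, le_sInf_iff]
    exact fun P hP => hs.2 ⟨hP.2, hP.1⟩ (le_maximalIdeal hP.2.ne_top)
  · rw [← maximalIdeal_height_eq_ringKrullDim, ← hcard]
    rfl

open IsLocalRing in
theorem IsLocalRing.exists_parameters_containing (R : Type*) [CommRing R] [IsDomain R]
    [IsLocalRing R] [IsNoetherianRing R] (y : R) (hy : y ∈ maximalIdeal R) :
    ∃ (d : ℕ) (x : Fin d → R), (∀ i, x i ∈ maximalIdeal R) ∧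
      (∃ N, maximalIdeal R ^ N ≤ Ideal.span {y} ⊔ Ideal.span (Set.range x)) ∧
      d ≤ ringKrullDim R ∧ (y ≠ 0 → (d + 1 : ℕ) ≤ ringKrullDim R) := by
  have : Nontrivial (R ⧸ Ideal.span {y}) := Ideal.Quotient.nontrivial_iff.mpr fun h =>
    (maximalIdeal.isMaximal R).ne_top (top_le_iff.mp (h ▸ (by simpa [Ideal.span_le] using hy)))
  have : IsLocalRing (R ⧸ Ideal.span {y}) :=
    .of_surjective' (Ideal.Quotient.mk _) Ideal.Quotient.mk_surjective
  obtain ⟨d, x, hx, ⟨N, hN⟩, hd⟩ := IsLocalRing.exists_parameters (R ⧸ Ideal.span {y})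
  choose z hz using fun i => Ideal.Quotient.mk_surjective (x i)
  have hm := IsLocalRing.map_maximalIdeal_of_surjective (Ideal.Quotient.mk (Ideal.span {y}))
    Ideal.Quotient.mk_surjective
  refine ⟨d, z, fun i => ?_, ⟨N, ?_⟩, hd.trans (ringKrullDim_quotient_le _), fun h => ?_⟩
  · have := hx i
    rw [← hz, mem_maximalIdeal, mem_nonunits_iff] at this
    exact fun hu => this (hu.map _)
  · rw [← hm, ← Ideal.map_pow, Ideal.map_le_iff_le_comap] at hN
    refine hN.trans ?_
    have : Set.range x = Ideal.Quotient.mk (Ideal.span {y}) '' Set.range z := by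
      rw [← Set.range_comp]; exact congrArg _ (funext fun i => (hz i).symm)
    rw [this, ← Ideal.map_span,
      Ideal.comap_map_of_surjective' _ Ideal.Quotient.mk_surjective, Ideal.mk_ker, sup_comm]
  · rw [← ringKrullDim_quotient_span_singleton_succ_eq_ringKrullDim_of_mem_nonZeroDivisors
      (mem_nonZeroDivisors_of_ne_zero h) hy]
    push_cast
    exact add_le_add_left hd 1

open IsLocalRing in
theorem Module.Finite.of_isAdicComplete_of_pow_le_map (T R : Type*) [CommRing T] (J : Ideal T)
    [IsPrecomplete J T] [CommRing R] [IsLocalRing R] [IsNoetherianRing R]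
    [Algebra T R] (hres : Function.Surjective ((residue R).comp (algebraMap T R)))
    (hJ : J.map (algebraMap T R) ≤ maximalIdeal R) {N : ℕ}
    (hN : maximalIdeal R ^ N ≤ J.map (algebraMap T R)) : Module.Finite T R := by
  have key : ∀ i, ∃ W : Submodule T R, W.FG ∧
      W ⊔ (maximalIdeal R ^ i).restrictScalars T = ⊤ := fun i => by
    induction i with
    | zero => exact ⟨⊥, Submodule.fg_bot, by simp⟩
    | succ i ih =>
      obtain ⟨W, hW, h⟩ := ih
      obtain ⟨s, hs⟩ : (maximalIdeal R ^ i).FG := IsNoetherian.noetherian _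
      refine ⟨W ⊔ Submodule.span T s, hW.sup ⟨s, rfl⟩, ?_⟩
      rw [eq_top_iff, ← h, sup_assoc]
      refine sup_le_sup_left (fun x hx => ?_) _
      rw [Submodule.restrictScalars_mem, ← hs] at hx
      induction hx using Submodule.span_induction with
      | mem x hx => exact Submodule.mem_sup_left (Submodule.subset_span hx)
      | zero => exact zero_mem _
      | add x y _ _ hx hy => exact add_mem hx hy
      | smul a x hx' hx =>
        obtain ⟨t, ht⟩ := hres (residue R a)
        have hm : a - algebraMap T R t ∈ maximalIdeal R := by
          rw [← residue_eq_zero_iff, map_sub, sub_eq_zero, ← ht]; rfl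
        have : a • x = t • x + (a - algebraMap T R t) * x := by
          rw [Algebra.smul_def t, smul_eq_mul]; ring
        rw [this]
        refine add_mem (Submodule.smul_mem _ _ hx) (Submodule.mem_sup_right ?_)
        rw [Submodule.restrictScalars_mem, pow_succ']
        exact Ideal.mul_mem_mul hm (hs ▸ hx')
  obtain ⟨W, hW, h⟩ := key N
  have : IsHausdorff J R := ⟨fun x hx => IsHausdorff.haus' (I := maximalIdeal R) x fun n => by
    have := hx n
    rw [SModEq.zero] at this ⊢
    rw [Ideal.smul_top_eq_map, Ideal.map_pow] at this
    rw [smul_eq_mul, Ideal.mul_top]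
    exact Ideal.pow_right_mono hJ n this⟩
  refine ⟨?_⟩
  rw [← Module.Finite.of_isPrecomplete_of_sup_eq_top J W hW ?_]
  · exact hW
  · refine top_le_iff.mp (h.symm.le.trans (sup_le_sup_left (fun x hx => ?_) _))
    rw [Ideal.smul_top_eq_map]
    exact hN hx

open IsLocalRing in
/-- Cohen's structure theorem: a complete Noetherian local domain is finite over a power series
ring over a coefficient ring. -/
theorem IsLocalRing.exists_finite_injective_mvPowerSeries (R : Type u) [CommRing R] [IsDomain R]
    [IsLocalRing R] [IsNoetherianRing R] [IsAdicComplete (maximalIdeal R) R] :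
    ∃ (V : Type u) (_ : CommRing V) (_ : IsDomain V) (_ : IsNoetherianRing V)
      (_ : IsIntegrallyClosed V) (d : ℕ) (ψ : MvPowerSeries (Fin d) V →+* R),
      (IsField V ∨ CharZero V) ∧ Function.Injective ψ ∧ ψ.Finite := by
  classical
  obtain ⟨V, _, _, _, _, _, π, φ, hV, hm, hVc, hπ, hπm, hres⟩ :=
    IsLocalRing.exists_coefficientRing R
  obtain ⟨d, x, hx, ⟨N, hN⟩, hd, hd'⟩ := IsLocalRing.exists_parameters_containing R (φ π) hπm
  obtain ⟨ψ, hψC, hψX⟩ := MvPowerSeries.exists_ringHom_extension (maximalIdeal R) φ x hx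
  set T := MvPowerSeries (Fin d) V
  let s : Finset V := if π = 0 then ∅ else {π}
  have hs : Ideal.span (s : Set V) = maximalIdeal V := by
    by_cases h : π = 0 <;> simp [s, h, hm]
  obtain ⟨hT, t, ht, hst⟩ :=
    MvPowerSeries.isAdicComplete_and_exists_span_eq_maximalIdeal s hs d
  let _ : Algebra T R := ψ.toAlgebra
  have hresT : Function.Surjective ((residue R).comp (algebraMap T R)) := fun r => by
    obtain ⟨v, rfl⟩ := hres r
    exact ⟨MvPowerSeries.C v, congrArg (residue R) (hψC v)⟩
  have hker : ∀ f : T, f ∈ maximalIdeal T ↔ ψ f ∈ maximalIdeal R := fun f => by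
    have := RingHom.ker_isMaximal_of_surjective _ hresT
    rw [← IsLocalRing.eq_maximalIdeal this, RingHom.mem_ker, RingHom.comp_apply,
      residue_eq_zero_iff]
    rfl
  have hfin : Module.Finite T R := by
    refine Module.Finite.of_isAdicComplete_of_pow_le_map T R (maximalIdeal T) hresT
      (Ideal.map_le_iff_le_comap.mpr fun f hf => (hker f).mp hf) (hN.trans ?_)
    rw [sup_le_iff, Ideal.span_singleton_le_iff_mem, Ideal.span_le]
    refine ⟨?_, ?_⟩
    · rw [← hψC]
      exact Ideal.mem_map_of_mem (algebraMap T R) ((hker _).mpr (by rwa [hψC]))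
    · rintro _ ⟨i, rfl⟩
      rw [SetLike.mem_coe, ← hψX]
      exact Ideal.mem_map_of_mem (algebraMap T R) ((hker _).mpr (by rw [hψX]; exact hx i))
  have hdim : ringKrullDim T ≤ ringKrullDim R := by
    have h1 : (maximalIdeal T).spanFinrank ≤ s.card + d := by
      rw [← hst]
      exact (Submodule.spanFinrank_span_le_ncard_of_finite t.finite_toSet).trans
        (by rwa [Set.ncard_coe_finset])
    have h2 : ((s.card + d : ℕ) : WithBot ℕ∞) ≤ ringKrullDim R := by
      by_cases h : π = 0
      · simpa [s, h] using hd
      · have := hd' (fun h' => h (hπ h'))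
        simpa [s, h, add_comm] using this
    exact (ringKrullDim_le_spanFinrank_maximalIdeal T).trans (le_trans (by exact_mod_cast h1) h2)
  exact ⟨V, inferInstance, inferInstance, inferInstance, inferInstance, d, ψ, hV,
    Algebra.algebraMap_injective_of_ringKrullDim_le T R hdim, hfin⟩

open IsLocalRing in
/-- An integral submodule of the fraction field of a complete Noetherian local domain is finitely
generated. -/
theorem IsLocalRing.isIntegral_submodule_fractionRing_fg (R : Type u) [CommRing R] [IsDomain R]
    [IsLocalRing R] [IsNoetherianRing R] [IsAdicComplete (maximalIdeal R) R]
    (M : Submodule R (FractionRing R)) (hM : ∀ m ∈ M, IsIntegral R m) : M.FG := by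
  obtain ⟨V, _, _, _, _, d, ψ, hV, hψ, hfin⟩ :=
    IsLocalRing.exists_finite_injective_mvPowerSeries R
  set T := MvPowerSeries (Fin d) V
  let _ : Algebra T R := ψ.toAlgebra
  have : FaithfulSMul T R := (faithfulSMul_iff_algebraMap_injective T R).mpr hψ
  have : Module.Finite T R := hfin
  let _ : Algebra (FractionRing T) (FractionRing R) := FractionRing.liftAlgebra T (FractionRing R)
  have : FiniteDimensional (FractionRing T) (FractionRing R) :=
    .of_isLocalization T R (nonZeroDivisors T)
  refine Submodule.FG.of_restrictScalars T (MvPowerSeries.isIntegral_submodule_fg V hV d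
    (FractionRing T) (FractionRing R) (M.restrictScalars T) fun m hm => ?_)
  exact isIntegral_trans (R := T) (A := R) m (hM m hm)

open IsLocalRing in
/-- Let `S` be a complete Noetherian local ring mapping to a field `L`. An `S`-submodule of `L`
which consists of integral fractions is finitely generated. -/
theorem IsLocalRing.isIntegral_submodule_fg (S : Type u) [CommRing S] [IsLocalRing S]
    [IsNoetherianRing S] [IsAdicComplete (maximalIdeal S) S] (L : Type*) [Field L] [Algebra S L]
    (M : Submodule S L) (hM : ∀ m ∈ M, IsIntegral S m ∧
      ∃ s s', algebraMap S L s ≠ 0 ∧ algebraMap S L s * m = algebraMap S L s') : M.FG := by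
  let P := RingHom.ker (algebraMap S L)
  let R := S ⧸ P
  have hP : P.IsPrime := RingHom.ker_isPrime _
  have hmk : Function.Surjective (Ideal.Quotient.mk P) := Ideal.Quotient.mk_surjective
  have : IsLocalRing R := IsLocalRing.of_surjective' _ hmk
  have := IsAdicComplete.of_surjective_of_isLocalRing _ hmk
  let κ : R →+* L := RingHom.kerLift (algebraMap S L)
  have hκ : Function.Injective κ := RingHom.kerLift_injective _
  let ι : FractionRing R →+* L := IsFractionRing.lift hκ
  have hι (s : S) : ι (algebraMap R _ (Ideal.Quotient.mk P s)) = algebraMap S L s := by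
    rw [IsFractionRing.lift_algebraMap]; rfl
  let M' : Submodule R (FractionRing R) :=
    { carrier := {q | ι q ∈ M}
      add_mem' := fun ha hb => by simpa using M.add_mem ha hb
      zero_mem' := by simp
      smul_mem' := fun r q hq => by
        obtain ⟨s, rfl⟩ := hmk r
        have := M.smul_mem s hq
        rwa [Algebra.smul_def, ← hι, ← map_mul, ← Algebra.smul_def] at this }
  have hfg : M'.FG := by
    refine IsLocalRing.isIntegral_submodule_fractionRing_fg R M' fun q hq => ?_
    obtain ⟨p, hp, hpq⟩ := (hM _ hq).1
    refine ⟨p.map (Ideal.Quotient.mk P), hp.map _, ι.injective ?_⟩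
    rw [Polynomial.eval₂_map, Polynomial.hom_eval₂, map_zero, ← hpq]
    congr 1
    ext s
    exact hι s
  obtain ⟨G, hG⟩ := hfg
  classical
  refine ⟨G.image ι, le_antisymm ?_ fun m hm => ?_⟩
  · rw [Submodule.span_le]
    intro x hx
    obtain ⟨q, hq, rfl⟩ := Finset.mem_image.mp hx
    exact (hG.le (Submodule.subset_span hq) : q ∈ M')
  · obtain ⟨-, s, s', hs, hss⟩ := hM m hm
    have hq : m = ι (algebraMap R _ (Ideal.Quotient.mk P s') /
        algebraMap R _ (Ideal.Quotient.mk P s)) := by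
      rw [map_div₀, hι, hι, ← hss, mul_div_cancel_left₀ _ hs]
    have key (q : FractionRing R) (hq : q ∈ Submodule.span R (G : Set (FractionRing R))) :
        ι q ∈ Submodule.span S ((G.image ι : Finset L) : Set L) := by
      induction hq using Submodule.span_induction with
      | mem x hx => exact Submodule.subset_span (Finset.mem_image_of_mem _ hx)
      | zero => simp
      | add x y _ _ hx hy => simpa using add_mem hx hy
      | smul r x _ hx =>
        obtain ⟨s, rfl⟩ := hmk r
        have := Submodule.smul_mem _ s hx
        rwa [Algebra.smul_def, ← hι, ← map_mul, ← Algebra.smul_def] at this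
    rw [hq] at hm ⊢
    exact key _ (hG.ge (show _ ∈ M' from hm))

theorem MvPowerSeries.mem_span_range_X {σ B : Type*} [Finite σ] [CommRing B]
    {f : MvPowerSeries σ B} (hf : constantCoeff f = 0) :
    f ∈ Ideal.span (Set.range (X : σ → MvPowerSeries σ B)) := by
  classical
  have := Fintype.ofFinite σ
  suffices H : ∀ (U : Finset σ) (f : MvPowerSeries σ B),
      (∀ m : σ →₀ ℕ, (∀ i ∈ U, m i = 0) → coeff m f = 0) →
      f ∈ Ideal.span (Set.range (X : σ → MvPowerSeries σ B)) by
    refine H Finset.univ f fun m hm => ?_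
    obtain rfl : m = 0 := Finsupp.ext fun i => hm i (Finset.mem_univ i)
    simpa using hf
  intro U
  induction U using Finset.induction_on with
  | empty =>
    intro f hf
    rw [show f = 0 from MvPowerSeries.ext fun m => hf m (by simp)]
    exact zero_mem _
  | insert i U _ ih =>
    intro f hf
    let g : MvPowerSeries σ B := fun m => if m i = 0 then coeff m f else 0
    have hg (m : σ →₀ ℕ) : coeff m g = if m i = 0 then coeff m f else 0 := rfl
    have h1 : g ∈ Ideal.span (Set.range (X : σ → MvPowerSeries σ B)) := ih g fun m hm => by
      rw [hg]
      split_ifs with h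
      · exact hf m (by simpa [h] using hm)
      · rfl
    have h2 : (X i : MvPowerSeries σ B) ∣ f - g := by
      rw [X_dvd_iff]
      intro m hm
      rw [map_sub, hg, if_pos hm, sub_self]
    rw [← sub_add_cancel f g]
    exact add_mem (Ideal.mem_of_dvd _ h2 (Ideal.subset_span ⟨i, rfl⟩)) h1

/-- The Rees algebra of a finitely generated ideal is contained in the range of a ring
homomorphism from a power series ring, whose values have their `n`-th coefficient in `I ^ n`. -/
theorem Ideal.exists_mvPowerSeries_ringHom {B : Type*} [CommRing B] (J : Ideal B)
    [IsAdicComplete J B] {r : ℕ} (a : Fin r → B) (I : Ideal B)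
    (hI : Ideal.span (Set.range a) = I) :
    ∃ ψ : MvPowerSeries (Fin r) B →+* PowerSeries B,
      (∀ s n, PowerSeries.coeff n (ψ s) ∈ I ^ n) ∧
      ∀ n, ∀ b ∈ I ^ n, PowerSeries.monomial n b ∈ ψ.range := by
  have := PowerSeries.isAdicComplete_sup J
  have ha (i : Fin r) : a i ∈ I := hI ▸ Ideal.subset_span ⟨i, rfl⟩
  obtain ⟨ψ, hC, hX⟩ := MvPowerSeries.exists_ringHom_extension
    (J.map PowerSeries.C ⊔ Ideal.span {PowerSeries.X}) (PowerSeries.C (R := B))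
    (fun i => PowerSeries.monomial 1 (a i)) (fun i => by
      refine Ideal.mem_sup_right (Ideal.mem_span_singleton.mpr ⟨PowerSeries.C (a i), ?_⟩)
      rw [PowerSeries.monomial_eq_mk]
      ext n
      simp [PowerSeries.coeff_X, mul_comm])
  refine ⟨ψ, fun s n => ?_, fun n => ?_⟩
  · induction n generalizing s with
    | zero => simp
    | succ n ih =>
      have h := MvPowerSeries.mem_span_range_X
        (f := s - MvPowerSeries.C (MvPowerSeries.constantCoeff s)) (by simp)
      have hs : PowerSeries.coeff (n + 1) (ψ s) = PowerSeries.coeff (n + 1)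
          (ψ (s - MvPowerSeries.C (MvPowerSeries.constantCoeff s))) := by
        rw [map_sub, hC, map_sub, PowerSeries.coeff_C]
        simp
      rw [hs]
      generalize s - MvPowerSeries.C (MvPowerSeries.constantCoeff s) = t at h
      obtain ⟨c, rfl⟩ := (Submodule.mem_span_range_iff_exists_fun _).mp h
      rw [map_sum, map_sum]
      refine Ideal.sum_mem _ fun i _ => ?_
      have hmon : PowerSeries.monomial 1 (a i) = PowerSeries.C (a i) * PowerSeries.X := by
        rw [← PowerSeries.monomial_zero_eq_C_apply, PowerSeries.X_eq,
          PowerSeries.monomial_mul_monomial, zero_add, mul_one]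
      rw [smul_eq_mul, map_mul, hX, hmon, ← mul_assoc, PowerSeries.coeff_succ_mul_X,
        PowerSeries.coeff_mul_C, pow_succ]
      exact Ideal.mul_mem_mul (ih _) (ha i)
  · induction n with
    | zero => exact fun b _ => ⟨MvPowerSeries.C b, by rw [hC, PowerSeries.monomial_zero_eq_C_apply]⟩
    | succ n ih =>
      intro b hb
      rw [pow_succ'] at hb
      induction hb using Submodule.mul_induction_on' with
      | mem_mul_mem x hx y hy =>
        rw [add_comm, ← PowerSeries.monomial_mul_monomial]
        refine mul_mem ?_ (ih y hy)
        rw [← hI] at hx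
        induction hx using Submodule.span_induction with
        | mem x hx =>
          obtain ⟨i, rfl⟩ := hx
          exact ⟨_, hX i⟩
        | zero => simp
        | add x y _ _ hx hy => simpa using add_mem hx hy
        | smul u x _ hx =>
          have := mul_mem (s := ψ.range) ⟨_, hC u⟩ hx
          rwa [← PowerSeries.monomial_zero_eq_C_apply, PowerSeries.monomial_mul_monomial,
            zero_add] at this
      | add x _ y _ hx hy => simpa using add_mem hx hy

/-- `x` satisfies an equation of integral dependence on `I`. -/
def Ideal.IsIntegralOver {B : Type*} [CommRing B] (I : Ideal B) (x : B) : Prop :=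
  ∃ k : ℕ, 0 < k ∧ ∃ a : ℕ → B,
    (∀ j : ℕ, 1 ≤ j → j ≤ k → a j ∈ I ^ j) ∧
    x ^ k + ∑ j ∈ Finset.Icc 1 k, a j * x ^ (k - j) = 0

theorem Ideal.IsIntegralOver.pow_mem {B : Type*} [CommRing B] {I : Ideal B} {x : B}
    (h : I.IsIntegralOver x) : ∃ k, x ^ k ∈ I := by
  obtain ⟨k, -, a, ha, h⟩ := h
  refine ⟨k, ?_⟩
  rw [eq_neg_of_add_eq_zero_left h]
  refine neg_mem (Ideal.sum_mem _ fun j hj => Ideal.mul_mem_right _ _ ?_)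
  rw [Finset.mem_Icc] at hj
  exact Ideal.pow_le_self (by omega) (ha j hj.1 hj.2)

theorem Ideal.IsIntegralOver.map {B C : Type*} [CommRing B] [CommRing C] (f : B →+* C)
    {I : Ideal B} {x : B} (h : I.IsIntegralOver x) : (I.map f).IsIntegralOver (f x) := by
  obtain ⟨k, hk, a, ha, h⟩ := h
  refine ⟨k, hk, fun j => f (a j), fun j h1 h2 => ?_, ?_⟩
  · rw [← Ideal.map_pow]
    exact Ideal.mem_map_of_mem f (ha j h1 h2)
  · simpa using congrArg f h

/-- If `x` is integral over `I ^ n`, then `x t ^ n` is integral over the Rees algebra of `I`. -/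
theorem Ideal.IsIntegralOver.isIntegralElem_monomial {S B : Type*} [CommRing S] [CommRing B]
    {I : Ideal B} {n : ℕ} {x : B} (h : (I ^ n).IsIntegralOver x) (ψ : S →+* PowerSeries B)
    (hψ : ∀ n, ∀ b ∈ I ^ n, PowerSeries.monomial n b ∈ ψ.range) :
    ψ.IsIntegralElem (PowerSeries.monomial n x) := by
  obtain ⟨k, hk, a, ha, h⟩ := h
  have hs (j : ℕ) : ∃ s, (1 ≤ j → j ≤ k → ψ s = PowerSeries.monomial (n * j) (a j)) := by
    by_cases hj : 1 ≤ j ∧ j ≤ k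
    · have := ha j hj.1 hj.2
      rw [← pow_mul] at this
      obtain ⟨s, hs⟩ := hψ _ _ this
      exact ⟨s, fun _ _ => hs⟩
    · exact ⟨0, fun h1 h2 => absurd ⟨h1, h2⟩ hj⟩
  choose s hs using hs
  refine ⟨Polynomial.X ^ k + ∑ j ∈ Finset.Icc 1 k, Polynomial.C (s j) * Polynomial.X ^ (k - j),
    ?_, ?_⟩
  · refine Polynomial.monic_X_pow_add ?_
    refine (Polynomial.degree_sum_le _ _).trans_lt ?_
    rw [Finset.sup_lt_iff (WithBot.bot_lt_coe _)]
    intro j hj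
    rw [Finset.mem_Icc] at hj
    refine (Polynomial.degree_C_mul_X_pow_le _ _).trans_lt ?_
    exact_mod_cast (by omega : k - j < k)
  · have hterm : ∀ j ∈ Finset.Icc 1 k, ψ (s j) * PowerSeries.monomial n x ^ (k - j) =
        PowerSeries.monomial (n * k) (a j * x ^ (k - j)) := by
      intro j hj
      rw [Finset.mem_Icc] at hj
      rw [hs j hj.1 hj.2, PowerSeries.monomial_pow, PowerSeries.monomial_mul_monomial]
      congr 2
      rw [mul_comm (k - j), ← mul_add]
      congr 1
      omega
    simp only [Polynomial.eval₂_add, Polynomial.eval₂_pow, Polynomial.eval₂_X,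
      Polynomial.eval₂_finsetSum, Polynomial.eval₂_mul, Polynomial.eval₂_C]
    rw [Finset.sum_congr rfl hterm, PowerSeries.monomial_pow, mul_comm k n, ← map_sum, ← map_add, h,
      map_zero]

open PowerSeries in
/-- If `x` is integral over `I ^ n`, then the image of `x t ^ n` in a field is a fraction of elements
of the image of the Rees algebra of `I`. -/
theorem Ideal.IsIntegralOver.exists_mul_monomial {S B L : Type*} [CommRing S] [CommRing B]
    [Field L] {I : Ideal B} {n : ℕ} {x : B} (h : (I ^ n).IsIntegralOver x)
    (ψ : S →+* PowerSeries B) (hψ : ∀ n, ∀ b ∈ I ^ n, monomial n b ∈ ψ.range)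
    (f : PowerSeries B →+* L) :
    ∃ s s', f (ψ s) ≠ 0 ∧ f (ψ s) * f (monomial n x) = f (ψ s') := by
  have hC (b : B) : ∃ s, ψ s = C b := by
    obtain ⟨s, hs⟩ := hψ 0 b (by simp)
    exact ⟨s, by rw [hs, monomial_zero_eq_C_apply]⟩
  obtain rfl | hn := Nat.eq_zero_or_pos n
  · obtain ⟨s, hs⟩ := hC x
    exact ⟨1, s, by simp, by rw [hs, map_one, map_one, one_mul, monomial_zero_eq_C_apply]⟩
  by_cases hI : ∀ a ∈ I, f (C a) = 0
  · obtain ⟨k, hk⟩ := h.pow_mem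
    have hx : f (C x) = 0 := by
      have := hI _ (Ideal.pow_le_self hn.ne' hk)
      rw [map_pow, map_pow] at this
      exact eq_zero_of_pow_eq_zero this
    refine ⟨1, 0, by simp, ?_⟩
    have : monomial n x = C x * X ^ n := by
      rw [← monomial_zero_eq_C_apply, X_pow_eq, monomial_mul_monomial, zero_add, mul_one]
    rw [this, map_mul f, hx]
    simp
  · push Not at hI
    obtain ⟨a, ha, ha'⟩ := hI
    obtain ⟨s, hs⟩ := hC (a ^ n)
    obtain ⟨t, ht⟩ := hC x
    obtain ⟨v, hv⟩ := hψ n (a ^ n) (Ideal.pow_mem_pow ha n)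
    refine ⟨s, t * v, ?_, ?_⟩
    · rw [hs, map_pow, map_pow]
      exact pow_ne_zero _ ha'
    · rw [← map_mul, map_mul ψ, hs, ht, hv, ← monomial_zero_eq_C_apply, ← monomial_zero_eq_C_apply,
        monomial_mul_monomial, monomial_mul_monomial, mul_comm]

theorem Submodule.fg_of_forall_map_fg {S D ι : Type*} [CommRing S] [IsNoetherianRing S]
    [AddCommGroup D] [Module S D] [Finite ι] {L : ι → Type*} [∀ i, AddCommGroup (L i)]
    [∀ i, Module S (L i)] (f : ∀ i, D →ₗ[S] L i) (hf : ∀ x, (∀ i, f i x = 0) → x = 0)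
    (M : Submodule S D) (hM : ∀ i, (M.map (f i)).FG) : M.FG := by
  have (i : ι) : Module.Finite S (M.map (f i)) := Module.Finite.iff_fg.mpr (hM i)
  let g : M →ₗ[S] ∀ i, M.map (f i) := LinearMap.pi fun i => (f i).submoduleMap M
  have hg : Function.Injective g := by
    rw [← LinearMap.ker_eq_bot, LinearMap.ker_eq_bot']
    intro m hm
    refine Subtype.ext (hf _ fun i => ?_)
    exact congrArg Subtype.val (congrFun hm i)
  have := isNoetherian_of_injective g hg
  exact Module.Finite.iff_fg.mp inferInstance

open IsLocalRing in
theorem IsLocalRing.span_fg_of_isIntegral (S : Type u) [CommRing S] [IsLocalRing S]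
    [IsNoetherianRing S] [IsAdicComplete (maximalIdeal S) S] {D ι : Type*} [CommRing D]
    [Algebra S D] [Finite ι] {L : ι → Type*} [∀ i, Field (L i)]
    (f : ∀ i, D →+* L i) (hf : ∀ x, (∀ i, f i x = 0) → x = 0) (Y : Set D)
    (hint : ∀ y ∈ Y, IsIntegral S y)
    (hfrac : ∀ i, ∀ y ∈ Y, ∃ s s', f i (algebraMap S D s) ≠ 0 ∧
      f i (algebraMap S D s) * f i y = f i (algebraMap S D s')) :
    (Submodule.span S Y).FG := by
  let _ (i : ι) : Algebra S (L i) := ((f i).comp (algebraMap S D)).toAlgebra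
  let F (i : ι) : D →ₐ[S] L i := { f i with commutes' := fun _ => rfl }
  refine Submodule.fg_of_forall_map_fg (fun i => (F i).toLinearMap) hf _ fun i => ?_
  refine IsLocalRing.isIntegral_submodule_fg S (L i) _ fun m hm => ?_
  obtain ⟨y, hy, rfl⟩ := Submodule.mem_map.mp hm
  constructor
  · refine IsIntegral.map (F i) ?_
    exact (Submodule.span_le (p := (integralClosure S D).toSubmodule)).mpr hint hy
  change ∃ s s', f i (algebraMap S D s) ≠ 0 ∧
    f i (algebraMap S D s) * f i y = f i (algebraMap S D s')
  induction hy using Submodule.span_induction with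
  | mem y hy => exact hfrac i y hy
  | zero => exact ⟨1, 0, by simp, by simp⟩
  | add x y _ _ hx hy =>
    obtain ⟨s, s', hs, hx⟩ := hx (Submodule.mem_map_of_mem ‹_›)
    obtain ⟨t, t', ht, hy⟩ := hy (Submodule.mem_map_of_mem ‹_›)
    refine ⟨s * t, s' * t + s * t', ?_, ?_⟩
    · rw [map_mul, map_mul]
      exact mul_ne_zero hs ht
    · simp only [map_mul, map_add, ← hx, ← hy]
      ring
  | smul u x _ hx =>
    obtain ⟨s, s', hs, hx⟩ := hx (Submodule.mem_map_of_mem ‹_›)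
    refine ⟨s, u * s', hs, ?_⟩
    rw [Algebra.smul_def, map_mul, map_mul, map_mul, ← hx]
    ring

open IsLocalRing PowerSeries in
/-- **Rees' theorem** for a complete local ring. -/
theorem IsLocalRing.exists_forall_isIntegralOver_mem_pow (B : Type u) [CommRing B] [IsLocalRing B]
    [IsNoetherianRing B] [IsReduced B] [IsAdicComplete (maximalIdeal B) B] (I : Ideal B) :
    ∃ c : ℕ, ∀ n x, (I ^ n).IsIntegralOver x → x ∈ I ^ (n - c) := by
  classical
  obtain ⟨r, a, ha⟩ := Submodule.fg_iff_exists_fin_generating_family.mp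
    (IsNoetherian.noetherian I)
  obtain ⟨ψ, hψ, hψ'⟩ := Ideal.exists_mvPowerSeries_ringHom (maximalIdeal B) a I ha
  let S := MvPowerSeries (Fin r) B
  obtain ⟨s, hs⟩ := IsNoetherian.noetherian (maximalIdeal B)
  have : IsAdicComplete (maximalIdeal S) S :=
    (MvPowerSeries.isAdicComplete_and_exists_span_eq_maximalIdeal s hs r).1
  let _ : Algebra S B⟦X⟧ := ψ.toAlgebra
  have : Finite (minimalPrimes B) := minimalPrimes.finite_of_isNoetherianRing B
  have hprime (P : minimalPrimes B) : P.1.IsPrime := P.2.1.1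
  let Y : Set B⟦X⟧ := {y | ∃ n x, (I ^ n).IsIntegralOver x ∧ monomial n x = y}
  let f (P : minimalPrimes B) : B⟦X⟧ →+* FractionRing (B ⧸ P.1)⟦X⟧ :=
    (algebraMap _ _).comp (PowerSeries.map (Ideal.Quotient.mk P.1))
  have hY : (Submodule.span S Y).FG := by
    refine IsLocalRing.span_fg_of_isIntegral S f (fun g hg => ?_) Y ?_ ?_
    · ext n
      have hn : PowerSeries.coeff n g ∈ sInf (minimalPrimes B) := by
        rw [Ideal.mem_sInf]
        intro P hP
        have := (map_eq_zero_iff _ (IsFractionRing.injective (B ⧸ P)⟦X⟧ _)).mp (hg ⟨P, hP⟩)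
        have := congrArg (PowerSeries.coeff n) this
        rwa [PowerSeries.coeff_map, map_zero, Ideal.Quotient.eq_zero_iff_mem] at this
      rw [minimalPrimes, Ideal.sInf_minimalPrimes] at hn
      obtain ⟨k, hk⟩ := hn
      rw [map_zero]
      exact eq_zero_of_pow_eq_zero hk
    · rintro _ ⟨n, x, hx, rfl⟩
      exact hx.isIntegralElem_monomial ψ hψ'
    · rintro P _ ⟨n, x, hx, rfl⟩
      exact hx.exists_mul_monomial ψ hψ' (f P)
  obtain ⟨Z, hZ, hYZ⟩ := (Submodule.fg_span_iff_fg_span_finset_subset Y).mp hY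
  have hdeg (z : B⟦X⟧) : ∃ n, z ∈ Z → ∃ x, monomial n x = z := by
    by_cases hz : z ∈ Z
    · obtain ⟨n, x, -, h⟩ := hZ hz
      exact ⟨n, fun _ => ⟨x, h⟩⟩
    · exact ⟨0, fun h => absurd h hz⟩
  choose deg hdeg using hdeg
  refine ⟨Z.sup deg, fun n x hx => ?_⟩
  suffices H : ∀ y ∈ Submodule.span S (Z : Set B⟦X⟧), ∀ n, coeff n y ∈ I ^ (n - Z.sup deg) by
    have := H (monomial n x) (hYZ.le (Submodule.subset_span ⟨n, x, hx, rfl⟩)) n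
    rwa [coeff_monomial_same] at this
  intro y hy
  induction hy using Submodule.span_induction with
  | mem z hz =>
    intro n
    obtain ⟨x, hx⟩ := hdeg z hz
    rw [← hx, coeff_monomial]
    split_ifs with h
    · rw [Nat.sub_eq_zero_of_le (h ▸ Finset.le_sup hz)]
      simp
    · exact zero_mem _
  | zero => simp
  | add x y _ _ hx hy => exact fun n => by simpa using add_mem (hx n) (hy n)
  | smul u x _ hx =>
    intro n
    rw [Algebra.smul_def, coeff_mul]
    refine Ideal.sum_mem _ fun p hp => ?_
    have hp := Finset.HasAntidiagonal.mem_antidiagonal.mp hp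
    have hle : n - Z.sup deg ≤ p.1 + (p.2 - Z.sup deg) := by omega
    refine Ideal.pow_le_pow_right hle ?_
    rw [pow_add]
    exact Ideal.mul_mem_mul (hψ u p.1) (hx p.2)

theorem Ideal.IsIntegralOver.mono {A : Type*} [CommRing A] {I J : Ideal A} (h : I ≤ J) {x : A}
    (hx : I.IsIntegralOver x) : J.IsIntegralOver x := by
  obtain ⟨k, hk, a, ha, h'⟩ := hx
  exact ⟨k, hk, a, fun j h1 h2 => Ideal.pow_right_mono h j (ha j h1 h2), h'⟩

theorem Ideal.IsIntegralOver.mul_mem {A : Type*} [CommRing A] {I J : Ideal A} {a x : A}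
    (ha : a ∈ I) (hx : J.IsIntegralOver x) : (I * J).IsIntegralOver (a * x) := by
  obtain ⟨k, hk, b, hb, h⟩ := hx
  refine ⟨k, hk, fun j => a ^ j * b j, fun j h1 h2 => ?_, ?_⟩
  · rw [mul_pow]
    exact Ideal.mul_mem_mul (Ideal.pow_mem_pow ha j) (hb j h1 h2)
  · rw [← mul_zero (a ^ k), ← h, mul_add, Finset.mul_sum, mul_pow]
    congr 1
    refine Finset.sum_congr rfl fun j hj => ?_
    rw [Finset.mem_Icc] at hj
    rw [mul_pow, ← Nat.add_sub_of_le hj.2, pow_add]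
    simp only [Nat.add_sub_cancel_left]
    ring

theorem Ideal.isIntegralOver_of_mem {A : Type*} [CommRing A] {I : Ideal A} {x : A} (hx : x ∈ I) :
    I.IsIntegralOver x := by
  refine ⟨1, one_pos, fun _ => -x, fun j h1 h2 => ?_, by simp⟩
  obtain rfl := le_antisymm h2 h1
  simpa using hx

theorem idealIC_mono {A : Type*} [CommRing A] {I J : Ideal A} (h : I ≤ J) :
    idealIC I ≤ idealIC J :=
  Ideal.span_mono fun _ hx => Ideal.IsIntegralOver.mono h hx

theorem le_idealIC {A : Type*} [CommRing A] (I : Ideal A) : I ≤ idealIC I :=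
  fun _ hx => Ideal.subset_span (Ideal.isIntegralOver_of_mem hx)

theorem mul_idealIC_le {A : Type*} [CommRing A] (I J : Ideal A) :
    I * idealIC J ≤ idealIC (I * J) := by
  rw [Ideal.mul_le]
  intro a ha x hx
  induction hx using Submodule.span_induction with
  | mem x hx => exact Ideal.subset_span (Ideal.IsIntegralOver.mul_mem ha hx)
  | zero => simp
  | add x y _ _ hx hy => rw [mul_add]; exact add_mem hx hy
  | smul r x _ hx => rw [smul_eq_mul, mul_left_comm]; exact Ideal.mul_mem_left _ _ hx

open IsLocalRing in
/-- Ideals of a Noetherian local ring are contracted from its completion. -/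
theorem IsLocalRing.comap_map_adicCompletion_le (A : Type*) [CommRing A] [IsNoetherianRing A]
    [IsLocalRing A] (J : Ideal A) {x : A} (hx : algebraMap A (AdicCompletion (maximalIdeal A) A) x ∈
      J.map (algebraMap A (AdicCompletion (maximalIdeal A) A))) : x ∈ J := by
  rw [← Ideal.Quotient.eq_zero_iff_mem]
  refine IsHausdorff.haus (I := maximalIdeal A) inferInstance _ fun n => ?_
  have h : Ideal.Quotient.mk (maximalIdeal A ^ n) x ∈
      J.map (Ideal.Quotient.mk (maximalIdeal A ^ n)) := by
    let e : AdicCompletion (maximalIdeal A) A →+* A ⧸ maximalIdeal A ^ n :=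
      (AdicCompletion.evalₐ (maximalIdeal A) n).toRingHom
    have := Ideal.mem_map_of_mem e hx
    rw [Ideal.map_map, ← RingHom.comp_apply] at this
    have hc : e.comp
        (algebraMap A (AdicCompletion (maximalIdeal A) A)) =
        Ideal.Quotient.mk (maximalIdeal A ^ n) := by
      ext a
      simp [e]
    rwa [hc] at this
  obtain ⟨y, hy, hyx⟩ := (Ideal.mem_map_iff_of_surjective _ Ideal.Quotient.mk_surjective).mp h
  rw [Ideal.Quotient.eq] at hyx
  rw [SModEq.zero]
  have : Ideal.Quotient.mk J x = (x - y) • (1 : A ⧸ J) := by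
    rw [Algebra.smul_def, mul_one, Ideal.Quotient.algebraMap_eq, map_sub,
      Ideal.Quotient.eq_zero_iff_mem.mpr hy, sub_zero]
  rw [this]
  exact Submodule.smul_mem_smul (by simpa using neg_mem hyx) trivial

/-- If `A` is an analytically unramified Noetherian local ring (its `𝔪`-adic completion is
reduced) and `I` an ideal, then `{Ī ⁿ}ₙ` is an `I`-good filtration: `I·Ī ⁿ ⊆ Ī ⁿ⁺¹` for
all `n` and `Ī ⁿ⁺¹ = I·Ī ⁿ` for all `n ≥ c`, for some `c`. -/
theorem integral_closure_filtration_good {A : Type*} [CommRing A] [IsNoetherianRing A]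
    [IsLocalRing A]
    (hred : IsReduced (AdicCompletion (IsLocalRing.maximalIdeal A) A)) (I : Ideal A) :
    (∀ n : ℕ, I * idealIC (I ^ n) ≤ idealIC (I ^ (n + 1))) ∧
      ∃ c : ℕ, ∀ n ≥ c, idealIC (I ^ (n + 1)) = I * idealIC (I ^ n) := by
  have hmul (n : ℕ) : I * idealIC (I ^ n) ≤ idealIC (I ^ (n + 1)) := by
    rw [pow_succ']
    exact mul_idealIC_le I (I ^ n)
  refine ⟨hmul, ?_⟩
  obtain ⟨c, hc⟩ := IsLocalRing.exists_forall_isIntegralOver_mem_pow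
    (AdicCompletion (IsLocalRing.maximalIdeal A) A) (I.map (algebraMap A _))
  have hle (n : ℕ) : idealIC (I ^ n) ≤ I ^ (n - c) := by
    refine Ideal.span_le.mpr fun x hx => ?_
    refine IsLocalRing.comap_map_adicCompletion_le A _ ?_
    rw [Ideal.map_pow]
    refine hc n _ ?_
    rw [← Ideal.map_pow]
    exact Ideal.IsIntegralOver.map _ hx
  let F : I.Filtration A :=
    { N := fun n => idealIC (I ^ (n + c))
      mono := fun n => idealIC_mono (Ideal.pow_le_pow_right (by omega))
      smul_le := fun n => by
        rw [smul_eq_mul, add_right_comm]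
        exact hmul _ }
  obtain ⟨n₀, hn₀⟩ := (I.stableFiltration_stable ⊤).of_le (F' := F) fun n => by
    have := hle (n + c)
    rw [Nat.add_sub_cancel] at this
    refine this.trans ?_
    change _ ≤ I ^ n • (⊤ : Ideal A)
    simp
  refine ⟨n₀ + c, fun n hn => ?_⟩
  obtain ⟨m, rfl⟩ : ∃ m, n = m + c := ⟨n - c, by omega⟩
  have := hn₀ m (by omega)
  rw [add_right_comm]
  exact this.symm
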